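/- arXiv:2512.10827 — 2 statements merged into one kernel-verified Lean document; each statement's English description precedes it below -/
import Mathlib

section
/- Every finite simple graph G has a linear forest F (a subgraph whose components are paths) satisfying: (1) each component of F is a path of length 2, 3, or 4 (i.e., a path on 3, 4, or 5 vertices); (2) the induced subgraph G − V(F) consists of isolated vertices and isolated edges, and every vertex of V(G) \ V(F) has degree at most (Δ(G)+1)/2 in G; (3) for every vertex v ∈ V(G) \ V(F) and every neighbor u of v in G with u ∈ V(F), the degree of u in F equals 2. -/
/-- `H` is (isomorphic to) a path on `n` vertices. -/
def IsPathOn {W : Type*} (H : SimpleGraph W) (n : ℕ) : Prop :=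
  Nonempty (H ≃g SimpleGraph.pathGraph n)

namespace SimpleGraph

variable {V : Type*} {G : SimpleGraph V}

/-- `p` lists the vertices of a path of `G` on at least three vertices. -/
structure IsLongPath (G : SimpleGraph V) (p : List V) : Prop where
  chain : p.IsChain G.Adj
  nodup : p.Nodup
  length : 3 ≤ p.length

/-- `R` is a family of pairwise disjoint paths of `G`, each on at least three vertices. -/
structure IsPathSystem (G : SimpleGraph V) (R : Finset (List V)) : Prop where
  isLongPath : ∀ p ∈ R, G.IsLongPath p
  disjoint : ∀ p ∈ R, ∀ q ∈ R, p ≠ q → ∀ v ∈ p, v ∉ q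

/-- `U` is the vertex set of a path system. -/
def Tiles (G : SimpleGraph V) (U : Set V) : Prop :=
  ∃ R : Finset (List V), G.IsPathSystem R ∧ ∀ v, v ∈ U ↔ ∃ p ∈ R, v ∈ p

/-- `U` is the vertex set of a path system in which `s` is an end of one of the paths. -/
def TilesFrom (G : SimpleGraph V) (U : Set V) (s : V) : Prop :=
  ∃ (q : List V) (U' : Set V), G.Tiles U' ∧ G.IsLongPath (s :: q) ∧ (∀ v ∈ s :: q, v ∉ U') ∧
    ∀ v, v ∈ U ↔ v ∈ U' ∨ v ∈ s :: q

/-- The path system `R` avoids `W` and covers the vertices of `B` outside `W`. -/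
structure IsRest (G : SimpleGraph V) (B : Finset V) (W : Set V) (R : Finset (List V)) : Prop where
  isPathSystem : G.IsPathSystem R
  disjoint : ∀ v ∈ W, ∀ p ∈ R, v ∉ p
  cover : ∀ b ∈ B, b ∈ W ∨ ∃ p ∈ R, b ∈ p

theorem isChain_reverse_adj {l : List V} : l.reverse.IsChain G.Adj ↔ l.IsChain G.Adj := by
  rw [List.isChain_reverse]
  simp only [G.adj_comm]

theorem IsLongPath.reverse {p : List V} (h : G.IsLongPath p) : G.IsLongPath p.reverse :=
  ⟨isChain_reverse_adj.2 h.chain, by simpa using h.nodup, by simpa using h.length⟩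

theorem tiles_empty : G.Tiles ∅ :=
  ⟨∅, ⟨by simp, by simp⟩, by simp⟩

theorem Tiles.union {U₁ U₂ U : Set V} (h₁ : G.Tiles U₁) (h₂ : G.Tiles U₂)
    (hd : ∀ v ∈ U₁, v ∉ U₂) (hU : ∀ v, v ∈ U ↔ v ∈ U₁ ∨ v ∈ U₂) : G.Tiles U := by
  classical
  obtain ⟨R₁, hR₁, h₁⟩ := h₁
  obtain ⟨R₂, hR₂, h₂⟩ := h₂
  refine ⟨R₁ ∪ R₂, ⟨?_, ?_⟩, ?_⟩
  · intro p hp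
    rcases Finset.mem_union.1 hp with hp | hp
    exacts [hR₁.isLongPath p hp, hR₂.isLongPath p hp]
  · intro p hp q hq hpq v hvp hvq
    rcases Finset.mem_union.1 hp with hp | hp <;> rcases Finset.mem_union.1 hq with hq | hq
    · exact hR₁.disjoint p hp q hq hpq v hvp hvq
    · exact hd v ((h₁ v).2 ⟨p, hp, hvp⟩) ((h₂ v).2 ⟨q, hq, hvq⟩)
    · exact hd v ((h₁ v).2 ⟨q, hq, hvq⟩) ((h₂ v).2 ⟨p, hp, hvp⟩)
    · exact hR₂.disjoint p hp q hq hpq v hvp hvq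
  · intro v
    rw [hU, h₁, h₂]
    simp only [Finset.mem_union]
    grind

theorem IsLongPath.tiles {p : List V} (h : G.IsLongPath p) : G.Tiles {v | v ∈ p} :=
  ⟨{p}, ⟨by simpa using h, by simp⟩, by simp⟩

theorem Tiles.add_path {U U' : Set V} (h : G.Tiles U) {p : List V} (hp : G.IsLongPath p)
    (hd : ∀ v ∈ p, v ∉ U) (hU : ∀ v, v ∈ U' ↔ v ∈ U ∨ v ∈ p) : G.Tiles U' :=
  h.union hp.tiles (fun v hv hv' => hd v hv' hv) hU

theorem TilesFrom.add_path {U U' : Set V} {s : V} (h : G.TilesFrom U s) {p : List V}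
    (hp : G.IsLongPath p) (hd : ∀ v ∈ p, v ∉ U) (hU : ∀ v, v ∈ U' ↔ v ∈ U ∨ v ∈ p) :
    G.TilesFrom U' s := by
  obtain ⟨q, U₁, h₁, hq, hdq, hU₁⟩ := h
  refine ⟨q, U₁ ∪ {v | v ∈ p}, h₁.add_path hp (fun v hv h => hd v hv ?_) (fun v => Iff.rfl),
    hq, ?_, ?_⟩
  · exact (hU₁ v).2 (Or.inl h)
  · rintro v hv (h | h)
    · exact hdq v hv h
    · exact hd v h ((hU₁ v).2 (Or.inr hv))
  · intro v
    rw [hU, hU₁]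
    simp only [Set.mem_union, Set.mem_ofPred_eq]
    tauto

/-- A path whose last vertex is adjacent to `s` can be attached to the path starting at `s`. -/
theorem TilesFrom.attach {U U' : Set V} {s : V} (h : G.TilesFrom U s) {l : List V}
    (hl : (l ++ [s]).IsChain G.Adj) (hn : l.Nodup) (hd : ∀ v ∈ l, v ∉ U)
    (hU : ∀ v, v ∈ U' ↔ v ∈ U ∨ v ∈ l) : G.Tiles U' := by
  obtain ⟨q, U₁, h₁, hq, hdq, hU₁⟩ := h
  refine h₁.add_path (p := l ++ s :: q) ⟨?_, ?_, ?_⟩ ?_ ?_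
  · exact List.isChain_split.2 ⟨hl, hq.chain⟩
  · refine List.nodup_append.2 ⟨hn, hq.nodup, ?_⟩
    rintro a ha b hb rfl
    exact hd a ha ((hU₁ a).2 (Or.inr hb))
  · have := hq.length
    simp only [List.length_append]
    lia
  · intro v hv hv'
    rcases List.mem_append.1 hv with hv | hv
    · exact hd v hv ((hU₁ v).2 (Or.inl hv'))
    · exact hdq v hv hv'
  · intro v
    rw [hU, hU₁, List.mem_append]
    tauto

theorem IsRest.tiles {B : Finset V} {W : Set V} {R : Finset (List V)} (h : G.IsRest B W R)
    (hW : G.Tiles W) : ∃ U, G.Tiles U ∧ ∀ b ∈ B, b ∈ U :=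
  ⟨W ∪ {v | ∃ p ∈ R, v ∈ p}, hW.union ⟨R, h.isPathSystem, fun _ => Iff.rfl⟩
    (fun v hv ⟨p, hp, hvp⟩ => h.disjoint v hv p hp hvp) (fun _ => Iff.rfl), h.cover⟩

theorem IsRest.erase [DecidableEq V] {B : Finset V} {W W' : Set V} {R : Finset (List V)}
    (h : G.IsRest B W R) {p : List V} (hp : p ∈ R) (hW' : ∀ v, v ∈ W' ↔ v ∈ W ∨ v ∈ p) :
    G.IsRest B W' (R.erase p) := by
  refine ⟨⟨fun q hq => h.isPathSystem.isLongPath q (Finset.mem_of_mem_erase hq),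
    fun q hq q' hq' => h.isPathSystem.disjoint q (Finset.mem_of_mem_erase hq) q'
      (Finset.mem_of_mem_erase hq')⟩, ?_, ?_⟩
  · intro v hv q hq hvq
    rcases (hW' v).1 hv with hv | hv
    · exact h.disjoint v hv q (Finset.mem_of_mem_erase hq) hvq
    · exact h.isPathSystem.disjoint p hp q (Finset.mem_of_mem_erase hq)
        (Finset.ne_of_mem_erase hq).symm v hv hvq
  · intro b hb
    rw [hW']
    rcases h.cover b hb with h | ⟨q, hq, hbq⟩
    · exact Or.inl (Or.inl h)
    · by_cases hqp : q = p
      · subst hqp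
        exact Or.inl (Or.inr hbq)
      · exact Or.inr ⟨q, Finset.mem_erase.2 ⟨hqp, hq⟩, hbq⟩

theorem IsRest.insert [DecidableEq V] {B : Finset V} {W W' : Set V} {R : Finset (List V)}
    (h : G.IsRest B W R) {p : List V} (hp : G.IsLongPath p)
    (hWW' : ∀ v ∈ W', v ∈ W) (hpR : ∀ v ∈ p, v ∈ W) (hpW' : ∀ v ∈ p, v ∉ W')
    (hW : ∀ b ∈ B, b ∈ W → b ∈ W' ∨ b ∈ p) : G.IsRest B W' (insert p R) := by
  refine ⟨⟨?_, ?_⟩, ?_, ?_⟩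
  · intro q hq
    rcases Finset.mem_insert.1 hq with rfl | hq
    exacts [hp, h.isPathSystem.isLongPath q hq]
  · intro q hq q' hq' hne v hv hv'
    rcases Finset.mem_insert.1 hq with hqp | hqR <;>
      rcases Finset.mem_insert.1 hq' with hqp' | hqR'
    · exact hne (hqp.trans hqp'.symm)
    · exact h.disjoint v (hpR v (hqp ▸ hv)) q' hqR' hv'
    · exact h.disjoint v (hpR v (hqp' ▸ hv')) q hqR hv
    · exact h.isPathSystem.disjoint q hqR q' hqR' hne v hv hv'
  · intro v hv q hq hvq
    rcases Finset.mem_insert.1 hq with rfl | hq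
    · exact hpW' v hvq hv
    · exact h.disjoint v (hWW' v hv) q hq hvq
  · intro b hb
    rcases h.cover b hb with h | ⟨q, hq, hbq⟩
    · exact (hW b hb h).imp id fun h => ⟨p, Finset.mem_insert_self _ _, h⟩
    · exact Or.inr ⟨q, Finset.mem_insert_of_mem hq, hbq⟩

/-- A family of legs `s :: r` (paths on one or two vertices, listed from their outer end `s`)
and a set `T` of centers, with union `W`, such that each leg can be left out of a tiling of `W`. -/
structure IsBouquet (G : SimpleGraph V) (T : Finset V) (S : Finset (V × List V)) (W : Set V) :
    Prop where
  mem_iff : ∀ v, v ∈ W ↔ v ∈ T ∨ ∃ x ∈ S, v ∈ x.1 :: x.2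
  chain : ∀ x ∈ S, (x.1 :: x.2).IsChain G.Adj
  nodup : ∀ x ∈ S, (x.1 :: x.2).Nodup
  length : ∀ x ∈ S, x.2.length ≤ 1
  disjoint : ∀ x ∈ S, ∀ y ∈ S, x ≠ y → ∀ v ∈ x.1 :: x.2, v ∉ y.1 :: y.2
  disjoint_centers : ∀ x ∈ S, ∀ v ∈ x.1 :: x.2, v ∉ T
  card : S.card = 2 * T.card + 1
  tiles : ∀ x ∈ S, G.Tiles {v | v ∈ W ∧ v ∉ x.1 :: x.2}
  tilesFrom : ∀ x ∈ S, ∀ y ∈ S, x ≠ y →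
    G.TilesFrom {v | v ∈ W ∧ v ∉ x.1 :: x.2} y.1 ∨ G.TilesFrom {v | v ∈ W ∧ v ∉ y.1 :: y.2} x.1
  not_adj : ∀ x ∈ S, ∀ y ∈ S, x ≠ y → ∀ v ∈ y.1 :: y.2, ¬ G.Adj x.1 v

/-- A path on three to five vertices with center `c` and legs `s :: r` and `s' :: r'`,
listed from their outer ends. -/
structure IsSpider (G : SimpleGraph V) (c s : V) (r : List V) (s' : V) (r' : List V) : Prop where
  chain : (s :: r ++ [c]).IsChain G.Adj
  chain' : (s' :: r' ++ [c]).IsChain G.Adj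
  nodup : (s :: r ++ c :: s' :: r').Nodup
  length : r.length ≤ 1
  length' : r'.length ≤ 1

theorem IsSpider.symm {c s s' : V} {r r' : List V} (h : G.IsSpider c s r s' r') :
    G.IsSpider c s' r' s r := by
  refine ⟨h.chain', h.chain, ?_, h.length', h.length⟩
  have := h.nodup
  grind

theorem IsSpider.disjoint {c s s' : V} {r r' : List V} (h : G.IsSpider c s r s' r') :
    ∀ v ∈ s :: r, v ∉ s' :: r' := by
  have := h.nodup
  grind

theorem IsSpider.center_notMem {c s s' : V} {r r' : List V} (h : G.IsSpider c s r s' r') :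
    c ∉ s :: r := by
  have := h.nodup
  grind

theorem IsSpider.nodup_leg {c s s' : V} {r r' : List V} (h : G.IsSpider c s r s' r') :
    (s :: r).Nodup :=
  (List.nodup_append.1 h.nodup).1

theorem IsSpider.isLongPath {c s s' : V} {r r' : List V} (h : G.IsSpider c s r s' r') :
    G.IsLongPath (s :: r ++ c :: (s' :: r').reverse) := by
  refine ⟨List.isChain_split.2 ⟨h.chain, ?_⟩, ?_, ?_⟩
  · have := isChain_reverse_adj.2 h.chain'
    simpa using this
  · exact ((((List.reverse_perm _).cons c).append_left (s :: r)).nodup_iff).2 h.nodup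
  · simp
    lia

/-- Replacing one leg of a spider by another path whose end is adjacent to the center. -/
theorem IsSpider.isLongPath_replace {c s s' a : V} {r r' q : List V} (h : G.IsSpider c s r s' r')
    (hac : G.Adj a c) (hq : (a :: q).IsChain G.Adj) (hn : (a :: q).Nodup)
    (hd : ∀ v ∈ a :: q, v ∉ s :: r ∧ v ≠ c) : G.IsLongPath (s :: (r ++ c :: a :: q)) := by
  refine ⟨?_, ?_, ?_⟩
  · rw [← List.cons_append]
    exact List.isChain_split.2 ⟨h.chain, List.IsChain.cons_cons hac.symm hq⟩
  · have := h.nodup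
    grind
  · simp
    lia

section extend

variable {T : Finset V} {S : Finset (V × List V)} {W W' : Set V}
  {x : V × List V} {c s s' : V} {r r' : List V}

theorem IsBouquet.mem_of_mem_leg (h : G.IsBouquet T S W) {x : V × List V} (hx : x ∈ S)
    {v : V} (hv : v ∈ x.1 :: x.2) : v ∈ W :=
  (h.mem_iff v).2 (Or.inr ⟨x, hx, hv⟩)

theorem IsBouquet.tiles_old (h : G.IsBouquet T S W) {y : V × List V} (hy : y ∈ S)
    (hQ : G.IsSpider c s r s' r')
    (hd : ∀ v ∈ s :: r ++ c :: s' :: r', v ∉ W)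
    (hW' : ∀ v, v ∈ W' ↔ v ∈ W ∨ v ∈ s :: r ++ c :: s' :: r') :
    G.Tiles {v | v ∈ W' ∧ v ∉ y.1 :: y.2} := by
  refine (h.tiles y hy).add_path hQ.isLongPath ?_ ?_
  · intro v hv hv'
    exact hd v (by simp at hv ⊢; tauto) hv'.1
  · intro v
    have h1 : v ∈ s :: r ++ c :: s' :: r' → v ∉ y.1 :: y.2 :=
      fun h1 h2 => hd v h1 (h.mem_of_mem_leg hy h2)
    simp only [Set.mem_ofPred_eq, hW', List.mem_append, List.mem_cons, List.mem_reverse] at h1 ⊢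
    tauto

theorem IsBouquet.tilesFrom_old (h : G.IsBouquet T S W) {y : V × List V} (hy : y ∈ S)
    (hQ : G.IsSpider c s r s' r')
    (hd : ∀ v ∈ s :: r ++ c :: s' :: r', v ∉ W)
    (hW' : ∀ v, v ∈ W' ↔ v ∈ W ∨ v ∈ s :: r ++ c :: s' :: r') :
    G.TilesFrom {v | v ∈ W' ∧ v ∉ y.1 :: y.2} s := by
  refine ⟨r ++ c :: (s' :: r').reverse, _, h.tiles y hy, hQ.isLongPath, ?_, ?_⟩
  · intro v hv hv'
    exact hd v (by simp at hv ⊢; tauto) hv'.1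
  · intro v
    have h1 : v ∈ s :: r ++ c :: s' :: r' → v ∉ y.1 :: y.2 :=
      fun h1 h2 => hd v h1 (h.mem_of_mem_leg hy h2)
    simp only [Set.mem_ofPred_eq, hW', List.mem_append, List.mem_cons, List.mem_reverse] at h1 ⊢
    tauto

theorem IsBouquet.tilesFrom_new (h : G.IsBouquet T S W) (hx : x ∈ S) (hxc : G.Adj x.1 c)
    (hQ : G.IsSpider c s r s' r')
    (hd : ∀ v ∈ s :: r ++ c :: s' :: r', v ∉ W)
    (hW' : ∀ v, v ∈ W' ↔ v ∈ W ∨ v ∈ s :: r ++ c :: s' :: r') :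
    G.TilesFrom {v | v ∈ W' ∧ v ∉ s' :: r'} s := by
  have hxW := fun v => h.mem_of_mem_leg hx (v := v)
  refine ⟨r ++ c :: x.1 :: x.2, _, h.tiles x hx, ?_, ?_, ?_⟩
  · refine hQ.isLongPath_replace hxc (h.chain x hx) (h.nodup x hx) fun v hv => ?_
    have := fun h => hd v h (hxW v hv)
    simp only [List.mem_append, List.mem_cons] at this ⊢
    tauto
  · rintro v hv ⟨h1, h2⟩
    have := fun h => hd v h h1
    simp only [List.mem_append, List.mem_cons] at this hv h2
    tauto
  · intro v
    have h1 := hd v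
    have h2 := hxW v
    have h3 := hQ.nodup
    simp only [Set.mem_ofPred_eq, hW']
    grind

theorem TilesFrom.tiles {U : Set V} {s : V} (h : G.TilesFrom U s) : G.Tiles U := by
  obtain ⟨q, U', h', hq, hd, hU⟩ := h
  exact h'.add_path hq hd hU

/-- If `y` can be left out with `a` an end, and `a` is adjacent to the inner vertex of `y`,
then `y` can be attached at `a`. -/
theorem TilesFrom.attach_leg {U : Set V} {a v : V} {y : V × List V}
    (h : G.TilesFrom {w | w ∈ U ∧ w ∉ y.1 :: y.2} a) (hy : (y.1 :: y.2).IsChain G.Adj)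
    (hn : (y.1 :: y.2).Nodup) (hl : y.2.length ≤ 1) (hyU : ∀ w ∈ y.1 :: y.2, w ∈ U)
    (hv : v ∈ y.2) (hav : G.Adj a v) : G.Tiles U := by
  obtain ⟨t, l⟩ := y
  match l, hl with
  | [w], _ =>
    obtain rfl : v = w := by simpa using hv
    refine h.attach (l := [t, v]) ?_ hn (fun w hw hw' => hw'.2 hw) fun w => ?_
    · simpa [hav.symm] using hy
    · have := hyU w
      simp only [Set.mem_ofPred_eq]
      tauto

/-- If one of two legs can be left out with the outer vertex of the other an end, and the
outer vertices are adjacent, then the legs can be joined. -/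
theorem TilesFrom.attach_outer {U : Set V} {a : V} {y : V × List V}
    (h : G.TilesFrom {w | w ∈ U ∧ w ∉ y.1 :: y.2} a) (hy : (y.1 :: y.2).IsChain G.Adj)
    (hn : (y.1 :: y.2).Nodup) (hyU : ∀ w ∈ y.1 :: y.2, w ∈ U)
    (hay : G.Adj a y.1) : G.Tiles U := by
  refine h.attach (l := (y.1 :: y.2).reverse) ?_ (List.nodup_reverse.2 hn) ?_ fun w => ?_
  · rw [← isChain_reverse_adj]
    simp [hay, hy]
  · intro w hw hw'
    exact hw'.2 (List.mem_reverse.1 hw)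
  · have := hyU w
    simp only [Set.mem_ofPred_eq, List.mem_reverse]
    tauto

theorem IsBouquet.not_adj_inner (h : G.IsBouquet T S W) (hx : x ∈ S) (hxc : G.Adj x.1 c)
    (hQ : G.IsSpider c s r s' r')
    (hd : ∀ v ∈ s :: r ++ c :: s' :: r', v ∉ W)
    (hW' : ∀ v, v ∈ W' ↔ v ∈ W ∨ v ∈ s :: r ++ c :: s' :: r')
    (hN : ¬ G.Tiles W') {y : V × List V} (hy : y ∈ S) (hxy : x ≠ y) {v : V} (hv : v ∈ r) :
    ¬ G.Adj y.1 v := by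
  intro hyv
  apply hN
  obtain rfl : r = [v] := by
    match r, hQ.length with
    | [w], _ =>
      obtain rfl : v = w := by simpa using hv
      rfl
  have hxW := fun v => h.mem_of_mem_leg hx (v := v)
  have hyW := fun v => h.mem_of_mem_leg hy (v := v)
  have hsv : G.Adj s v := by simpa using (List.isChain_cons_cons.1 hQ.chain).1
  have hQn := hQ.nodup
  rcases h.tilesFrom x hx y hy hxy with h' | h'
  · have h1 : G.Tiles ({w | w ∈ W ∧ w ∉ x.1 :: x.2} ∪ {w | w ∈ [s, v]}) := by
      refine h'.attach (l := [s, v]) ?_ ?_ ?_ fun w => Iff.rfl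
      · simp [hsv, hyv.symm]
      · simp [hsv.ne]
      · intro w hw hw'
        exact hd w (List.mem_append_left _ hw) hw'.1
    refine h1.add_path (p := s' :: (r' ++ c :: x.1 :: x.2))
      (hQ.symm.isLongPath_replace hxc (h.chain x hx) (h.nodup x hx) ?_) ?_ ?_
    · intro w hw
      have := fun h => hd w h (hxW w hw)
      simp only [List.mem_append, List.mem_cons] at this ⊢
      tauto
    · intro w hw
      have h1 := hd w
      have h2 := hxW w
      simp only [Set.mem_union, Set.mem_ofPred_eq]
      grind
    · intro w
      have h1 := hd w
      have h2 := hxW w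
      simp only [Set.mem_union, Set.mem_ofPred_eq, hW']
      grind
  · have h1 : G.Tiles ({w | w ∈ W ∧ w ∉ y.1 :: y.2} ∪ {w | w ∈ s' :: r' ++ [c]}) := by
      refine h'.attach (l := s' :: r' ++ [c]) ?_ ?_ ?_ fun w => Iff.rfl
      · rw [List.append_assoc]
        exact List.isChain_split.2 ⟨hQ.chain', by simpa using hxc.symm⟩
      · grind
      · intro w hw hw'
        refine hd w ?_ hw'.1
        simp only [List.mem_append, List.mem_cons] at hw ⊢
        tauto
    refine h1.add_path (p := [s, v] ++ y.1 :: y.2) ⟨?_, ?_, ?_⟩ ?_ ?_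
    · exact List.isChain_split.2 ⟨by simp [hsv, hyv.symm], h.chain y hy⟩
    · refine List.nodup_append.2 ⟨by simp [hsv.ne], h.nodup y hy, ?_⟩
      rintro a ha b hb rfl
      exact hd a (List.mem_append_left _ ha) (hyW a hb)
    · simp
    · intro w hw
      have h1 := hd w
      have h2 := hyW w
      simp only [Set.mem_union, Set.mem_ofPred_eq]
      grind
    · intro w
      have h1 := hd w
      have h2 := hyW w
      simp only [Set.mem_union, Set.mem_ofPred_eq, hW']
      grind

set_option maxHeartbeats 1000000 in
theorem IsBouquet.extend [DecidableEq V] (h : G.IsBouquet T S W) (hx : x ∈ S)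
    (hxc : G.Adj x.1 c) (hQ : G.IsSpider c s r s' r')
    (hd : ∀ v ∈ s :: r ++ c :: s' :: r', v ∉ W)
    (hW' : ∀ v, v ∈ W' ↔ v ∈ W ∨ v ∈ s :: r ++ c :: s' :: r')
    (hr : ∀ v ∈ r, ¬ G.Adj x.1 v) (hr' : ∀ v ∈ r', ¬ G.Adj x.1 v) (hN : ¬ G.Tiles W') :
    G.IsBouquet (insert c T) (insert (s, r) (insert (s', r') S)) W' := by
  have hmem : ∀ v, v ∈ s :: r ++ c :: s' :: r' ↔ v ∈ s' :: r' ++ c :: s :: r := by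
    intro v
    simp only [List.mem_append, List.mem_cons]
    tauto
  have hd₂ : ∀ v ∈ s' :: r' ++ c :: s :: r, v ∉ W := fun v hv => hd v ((hmem v).2 hv)
  have hW₂ : ∀ v, v ∈ W' ↔ v ∈ W ∨ v ∈ s' :: r' ++ c :: s :: r :=
    fun v => by rw [hW', hmem]
  have hlegW : ∀ y ∈ S, ∀ v ∈ y.1 :: y.2, v ∈ W := fun y hy v => h.mem_of_mem_leg hy
  have hTW : ∀ v ∈ T, v ∈ W := fun v hv => (h.mem_iff v).2 (Or.inl hv)
  have hcT : c ∉ T := fun hc => hd c (by simp) (hTW c hc)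
  have hS' : (s', r') ∉ S := fun hc => hd s' (by simp) (hlegW _ hc s' (by simp))
  have hSS' : (s, r) ∉ insert (s', r') S := by
    intro hc
    rcases Finset.mem_insert.1 hc with hc | hc
    · exact hQ.disjoint s (by simp) (by simp [(Prod.mk.inj hc).1])
    · exact hd s (by simp) (hlegW _ hc s (by simp))
  have hch : ∀ y ∈ insert (s, r) (insert (s', r') S), (y.1 :: y.2).IsChain G.Adj := by
    simp only [Finset.forall_mem_insert]
    exact ⟨(List.isChain_append.1 hQ.chain).1, (List.isChain_append.1 hQ.chain').1, h.chain⟩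
  have hnd : ∀ y ∈ insert (s, r) (insert (s', r') S), (y.1 :: y.2).Nodup := by
    simp only [Finset.forall_mem_insert]
    exact ⟨hQ.nodup_leg, hQ.symm.nodup_leg, h.nodup⟩
  have hle : ∀ y ∈ insert (s, r) (insert (s', r') S), y.2.length ≤ 1 := by
    simp only [Finset.forall_mem_insert]
    exact ⟨hQ.length, hQ.length', h.length⟩
  have hin : ∀ y ∈ insert (s, r) (insert (s', r') S), ∀ v ∈ y.1 :: y.2, v ∈ W' := by
    simp only [Finset.forall_mem_insert]
    refine ⟨fun v hv => (hW' v).2 (Or.inr (List.mem_append_left _ hv)),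
      fun v hv => (hW₂ v).2 (Or.inr (List.mem_append_left _ hv)),
      fun y hy v hv => (hW' v).2 (Or.inl (hlegW y hy v hv))⟩
  have hfrom : ∀ y ∈ insert (s, r) (insert (s', r') S), ∀ z ∈ insert (s, r) (insert (s', r') S),
      y ≠ z → G.TilesFrom {v | v ∈ W' ∧ v ∉ y.1 :: y.2} z.1 ∨
        G.TilesFrom {v | v ∈ W' ∧ v ∉ z.1 :: z.2} y.1 := by
    simp only [Finset.forall_mem_insert]
    refine ⟨⟨by simp, fun _ => Or.inl (h.tilesFrom_new hx hxc hQ.symm hd₂ hW₂),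
      fun y hy _ => Or.inr (h.tilesFrom_old hy hQ hd hW')⟩,
      ⟨fun _ => Or.inl (h.tilesFrom_new hx hxc hQ hd hW'), by simp,
      fun y hy _ => Or.inr (h.tilesFrom_old hy hQ.symm hd₂ hW₂)⟩,
      fun y hy => ⟨fun _ => Or.inl (h.tilesFrom_old hy hQ hd hW'),
        fun _ => Or.inl (h.tilesFrom_old hy hQ.symm hd₂ hW₂), fun z hz hyz => ?_⟩⟩
    have key : ∀ y ∈ S, ∀ z ∈ S, G.TilesFrom {v | v ∈ W ∧ v ∉ y.1 :: y.2} z.1 →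
        G.TilesFrom {v | v ∈ W' ∧ v ∉ y.1 :: y.2} z.1 := by
      intro y hy z hz h'
      refine h'.add_path hQ.isLongPath ?_ ?_
      · intro v hv hv'
        exact hd v (by simp at hv ⊢; tauto) hv'.1
      · intro v
        have h1 : v ∈ s :: r ++ c :: s' :: r' → v ∉ y.1 :: y.2 :=
          fun h1 h2 => hd v h1 (hlegW y hy v h2)
        simp only [Set.mem_ofPred_eq, hW', List.mem_append, List.mem_cons,
          List.mem_reverse] at h1 ⊢
        tauto
    exact (h.tilesFrom y hy z hz hyz).imp (key y hy z hz) (key z hz y hy)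
  have houter : ∀ y ∈ insert (s, r) (insert (s', r') S), ∀ z ∈ insert (s, r) (insert (s', r') S),
      y ≠ z → ¬ G.Adj y.1 z.1 := by
    intro y hy z hz hyz hadj
    rcases hfrom y hy z hz hyz with h' | h'
    · exact hN (h'.attach_outer (hch y hy) (hnd y hy) (hin y hy) hadj.symm)
    · exact hN (h'.attach_outer (hch z hz) (hnd z hz) (hin z hz) hadj)
  have hinner : ∀ y ∈ insert (s, r) (insert (s', r') S), ∀ z ∈ insert (s, r) (insert (s', r') S),
      y ≠ z → ∀ v ∈ z.2, ¬ G.Adj y.1 v := by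
    have key : ∀ y z, z ∈ insert (s, r) (insert (s', r') S) →
        G.TilesFrom {v | v ∈ W' ∧ v ∉ z.1 :: z.2} y → ∀ v ∈ z.2, ¬ G.Adj y v :=
      fun y z hz h' v hv hadj =>
        hN (h'.attach_leg (hch z hz) (hnd z hz) (hle z hz) (hin z hz) hv hadj)
    have key' : ∀ y z, z ∈ S →
        G.TilesFrom {v | v ∈ W' ∧ v ∉ z.1 :: z.2} y → ∀ v ∈ z.2, ¬ G.Adj y v :=
      fun y z hz => key y z (Finset.mem_insert_of_mem (Finset.mem_insert_of_mem hz))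
    simp only [Finset.forall_mem_insert]
    refine ⟨⟨by simp, fun _ => key s (s', r') (by simp) (h.tilesFrom_new hx hxc hQ hd hW'),
      fun z hz _ => key' s z hz (h.tilesFrom_old hz hQ hd hW')⟩,
      ⟨fun _ => key s' (s, r) (by simp) (h.tilesFrom_new hx hxc hQ.symm hd₂ hW₂), by simp,
      fun z hz _ => key' s' z hz (h.tilesFrom_old hz hQ.symm hd₂ hW₂)⟩,
      fun y hy => ⟨fun _ v hv => ?_, fun _ v hv => ?_,
        fun z hz hyz v hv => h.not_adj y hy z hz hyz v (List.mem_cons_of_mem _ hv)⟩⟩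
    · by_cases hxy : x = y
      · exact hxy ▸ hr v hv
      · exact h.not_adj_inner hx hxc hQ hd hW' hN hy hxy hv
    · by_cases hxy : x = y
      · exact hxy ▸ hr' v hv
      · exact h.not_adj_inner hx hxc hQ.symm hd₂ hW₂ hN hy hxy hv
  refine ⟨?_, hch, hnd, hle, ?_, ?_, ?_, ?_, hfrom, ?_⟩
  · intro v
    rw [hW', h.mem_iff]
    simp only [Finset.mem_insert, List.mem_append, List.mem_cons, exists_eq_or_imp]
    simp only [or_comm, or_left_comm, or_assoc]
  · simp only [Finset.forall_mem_insert]
    refine ⟨⟨by simp, fun _ => hQ.disjoint, fun y hy _ v hv hv' => ?_⟩,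
      ⟨fun _ => hQ.symm.disjoint, by simp, fun y hy _ v hv hv' => ?_⟩,
      fun y hy => ⟨fun _ v hv hv' => ?_, fun _ v hv hv' => ?_, h.disjoint y hy⟩⟩
    · exact hd v (List.mem_append_left _ hv) (hlegW y hy v hv')
    · exact hd₂ v (List.mem_append_left _ hv) (hlegW y hy v hv')
    · exact hd v (List.mem_append_left _ hv') (hlegW y hy v hv)
    · exact hd₂ v (List.mem_append_left _ hv') (hlegW y hy v hv)
  · simp only [Finset.forall_mem_insert]
    refine ⟨fun v hv hv' => ?_, fun v hv hv' => ?_, fun y hy v hv hv' => ?_⟩ <;>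
      rcases Finset.mem_insert.1 hv' with rfl | hv'
    · exact hQ.center_notMem hv
    · exact hd v (List.mem_append_left _ hv) (hTW v hv')
    · exact hQ.symm.center_notMem hv
    · exact hd₂ v (List.mem_append_left _ hv) (hTW v hv')
    · exact hd v (by simp) (hlegW y hy v hv)
    · exact h.disjoint_centers y hy v hv hv'
  · rw [Finset.card_insert_of_notMem hSS', Finset.card_insert_of_notMem hS', h.card,
      Finset.card_insert_of_notMem hcT]
    ring
  · simp only [Finset.forall_mem_insert]
    exact ⟨(h.tilesFrom_new hx hxc hQ.symm hd₂ hW₂).tiles,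
      (h.tilesFrom_new hx hxc hQ hd hW').tiles, fun y hy => h.tiles_old hy hQ hd hW'⟩
  · intro y hy z hz hyz v hv
    rcases List.mem_cons.1 hv with rfl | hv
    · exact houter y hy z hz hyz
    · exact hinner y hy z hz hyz v hv

end extend

theorem IsRest.mono {B : Finset V} {W W' : Set V} {R : Finset (List V)} (h : G.IsRest B W R)
    (hW : ∀ v ∈ W', v ∈ W) (hB : ∀ b ∈ B, b ∈ W → b ∈ W') : G.IsRest B W' R :=
  ⟨h.isPathSystem, fun v hv => h.disjoint v (hW v hv),
    fun b hb => (h.cover b hb).imp (hB b hb) id⟩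

/-- Two chains whose first vertices are adjacent, joined by that edge. -/
theorem isChain_reverse_append {a b : V} {q l : List V} (hq : (a :: q).IsChain G.Adj)
    (hl : (b :: l).IsChain G.Adj) (hab : G.Adj a b) :
    ((a :: q).reverse ++ b :: l).IsChain G.Adj := by
  refine List.isChain_split.2 ⟨?_, hl⟩
  rw [← isChain_reverse_adj]
  simp [hab.symm, hq]

/-- A leg attached to a vertex of a path that is an end or that cuts off at least three
vertices on one side. -/
theorem tiles_attach {a y : V} {q l₁ l₂ : List V} (hp : G.IsLongPath (l₁ ++ y :: l₂))
    (hq : (a :: q).IsChain G.Adj) (hn : (a :: q).Nodup) (hd : ∀ v ∈ a :: q, v ∉ l₁ ++ y :: l₂)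
    (hay : G.Adj a y) (hl : l₁ = [] ∨ 3 ≤ l₁.length ∧ l₂ ≠ []) :
    G.Tiles {v | v ∈ l₁ ++ y :: l₂ ∨ v ∈ a :: q} := by
  have hpn := List.nodup_append.1 hp.nodup
  have hpc := List.isChain_append.1 hp.chain
  have hmain : 3 ≤ ((a :: q).reverse ++ y :: l₂).length →
      G.IsLongPath ((a :: q).reverse ++ y :: l₂) := by
    refine fun h => ⟨isChain_reverse_append hq hpc.2.1 hay, ?_, h⟩
    refine List.nodup_append.2 ⟨List.nodup_reverse.2 hn, hpn.2.1, ?_⟩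
    rintro u hu v hv rfl
    exact hd u (List.mem_reverse.1 hu) (List.mem_append_right _ hv)
  rcases hl with rfl | ⟨hl₁, hl₂⟩
  · have hlen := hp.length
    refine tiles_empty.add_path (hmain ?_) (by simp) fun v => ?_
    · simp only [List.nil_append, List.length_cons, List.length_append, List.length_reverse] at *
      lia
    · simp
      tauto
  · have hlen := List.length_pos_of_ne_nil hl₂
    have h₁ : G.IsLongPath l₁ := ⟨hpc.1, hpn.1, hl₁⟩
    refine h₁.tiles.add_path (hmain ?_) (fun v hv hv' => ?_) fun v => ?_
    · simp only [List.length_cons, List.length_append, List.length_reverse]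
      lia
    · rcases List.mem_append.1 hv with hv | hv
      · exact hd v (List.mem_reverse.1 hv) (List.mem_append_left _ hv')
      · exact hpn.2.2 v hv' v hv rfl
    · simp
      tauto

theorem IsSpider.tiles_of_adj_inner {c s s' i a : V} {r' q : List V}
    (hQ : G.IsSpider c s [i] s' r') (hq : (a :: q).IsChain G.Adj) (hn : (a :: q).Nodup)
    (hd : ∀ v ∈ a :: q, v ∉ [s, i] ++ c :: s' :: r') (hac : G.Adj a c) (hai : G.Adj a i)
    (hr' : r' = [] → q = []) : G.Tiles {v | v ∈ [s, i] ++ c :: s' :: r' ∨ v ∈ a :: q} := by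
  have hQn := hQ.nodup
  have hsi : G.Adj s i := (List.isChain_cons_cons.1 hQ.chain).1
  match r', hQ.length' with
  | [], _ =>
    obtain rfl := hr' rfl
    have hs'c : G.Adj s' c := (List.isChain_cons_cons.1 hQ.chain').1
    refine tiles_empty.add_path (p := [s, i, a, c, s']) ⟨?_, ?_, by simp⟩ (by simp) fun v => ?_
    · simp [hsi, hai.symm, hac, hs'c.symm]
    · have := hd a (by simp)
      grind
    · simp
      tauto
  | [t], _ =>
    have h₁ : G.IsLongPath [s', t, c] := ⟨hQ.chain', by grind, by simp⟩
    refine h₁.tiles.add_path (p := [s, i] ++ a :: q) ⟨?_, ?_, by simp⟩ ?_ fun v => ?_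
    · exact List.isChain_split.2 ⟨by simp [hsi, hai.symm], hq⟩
    · refine List.nodup_append.2 ⟨by simp [hsi.ne], hn, ?_⟩
      rintro u hu v hv rfl
      exact hd u hv (List.mem_append_left _ hu)
    · intro v hv hv'
      have := hd v
      simp only [Set.mem_ofPred_eq] at hv'
      grind
    · simp
      tauto

/-- `v` is not adjacent to both inner vertices of a path on four vertices in `R`. -/
def NotInsertable (G : SimpleGraph V) (R : Finset (List V)) (v : V) : Prop :=
  ∀ a b c d, [a, b, c, d] ∈ R → G.Adj v b → ¬ G.Adj v c

theorem NotInsertable.mono {R R' : Finset (List V)} {v : V} (h : G.NotInsertable R v)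
    (hR : ∀ p ∈ R', p.length = 4 → p ∈ R) : G.NotInsertable R' v :=
  fun a b c d hp => h a b c d (hR _ hp rfl)

/-- A spider outside `W`, together with a path system `R'` covering the rest of `B`,
smaller than `R`. -/
structure IsGrowth (G : SimpleGraph V) (B : Finset V) (W : Set V) (R : Finset (List V)) (a : V)
    (c s : V) (r : List V) (s' : V) (r' : List V) (R' : Finset (List V)) : Prop where
  adj : G.Adj a c
  isSpider : G.IsSpider c s r s' r'
  disjoint : ∀ v ∈ s :: r ++ c :: s' :: r', v ∉ W
  isRest : G.IsRest B (W ∪ {v | v ∈ s :: r ++ c :: s' :: r'}) R'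
  card : R'.card < R.card
  subset : ∀ p ∈ R', p.length = 4 → p ∈ R
  inner : ∀ v ∈ r, ¬ G.Adj a v
  inner' : ∀ v ∈ r', ¬ G.Adj a v

section growth

variable {B : Finset V} {W : Set V} {R R' : Finset (List V)} {a c s s' : V} {r r' : List V}

theorem IsSpider.trim {i : V} (h : G.IsSpider c s [i] s' r') : G.IsSpider c i [] s' r' :=
  ⟨(List.isChain_cons_cons.1 h.chain).2, h.chain', (List.nodup_cons.1 h.nodup).2, by simp,
    h.length'⟩

theorem IsGrowth.symm (h : G.IsGrowth B W R a c s r s' r' R') :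
    G.IsGrowth B W R a c s' r' s r R' := by
  have hmem : ∀ v, v ∈ s' :: r' ++ c :: s :: r ↔ v ∈ s :: r ++ c :: s' :: r' := by
    intro v
    simp only [List.mem_append, List.mem_cons]
    tauto
  refine ⟨h.adj, h.isSpider.symm, fun v hv => h.disjoint v ((hmem v).1 hv), ?_, h.card, h.subset,
    h.inner', h.inner⟩
  simp only [hmem]
  exact h.isRest

/-- The first leg of a growth can be shortened until its outer vertex is in `B` and cannot be
inserted into a path of the rest. -/
theorem IsGrowth.exists_trim [DecidableEq V] (h : G.IsGrowth B W R a c s r s' r' R') :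
    ∃ s₁ r₁ R₁, G.IsGrowth B W R a c s₁ r₁ s' r' R₁ ∧
      (r₁ ≠ [] → s₁ ∈ B ∧ G.NotInsertable R₁ s₁) ∧ ∀ p ∈ R₁, p.length = 4 → p ∈ R' := by
  by_cases hg : r ≠ [] → s ∈ B ∧ G.NotInsertable R' s
  · exact ⟨s, r, R', h, hg, fun p hp _ => hp⟩
  push Not at hg
  obtain ⟨hr, hg⟩ := hg
  obtain ⟨i, rfl⟩ : ∃ i, r = [i] := List.length_eq_one_iff.1
    (le_antisymm h.isSpider.length (List.length_pos_of_ne_nil hr))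
  have hsub : ∀ v ∈ W ∪ {v | v ∈ [i] ++ c :: s' :: r'},
      v ∈ W ∪ {v | v ∈ [s, i] ++ c :: s' :: r'} := by
    rintro v (hv | hv)
    · exact Or.inl hv
    · exact Or.inr (List.mem_cons_of_mem _ hv)
  have hsW : s ∉ W ∪ {v | v ∈ [i] ++ c :: s' :: r'} := by
    rintro (hv | hv)
    · exact h.disjoint s (by simp) hv
    · exact (List.nodup_cons.1 h.isSpider.nodup).1 hv
  have hcase : ∀ v ∈ W ∪ {v | v ∈ [s, i] ++ c :: s' :: r'},
      v ∈ W ∪ {v | v ∈ [i] ++ c :: s' :: r'} ∨ v = s := by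
    rintro v (hv | hv)
    · exact Or.inl (Or.inl hv)
    · rcases List.mem_cons.1 hv with rfl | hv
      exacts [Or.inr rfl, Or.inl (Or.inr hv)]
  have hdisj : ∀ v ∈ [i] ++ c :: s' :: r', v ∉ W :=
    fun v hv => h.disjoint v (List.mem_cons_of_mem _ hv)
  by_cases hsB : s ∈ B
  · obtain ⟨t, u, v, w, hp, hu, hv⟩ : ∃ t u v w, [t, u, v, w] ∈ R' ∧ G.Adj s u ∧ G.Adj s v := by
      simpa [NotInsertable] using hg hsB
    have hsR : s ∈ W ∪ {v | v ∈ [s, i] ++ c :: s' :: r'} := Or.inr (by simp)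
    have hlong := h.isRest.isPathSystem.isLongPath _ hp
    have hsp := h.isRest.disjoint s hsR _ hp
    have hmem : ∀ z, z ∈ [t, u, s, v, w] ↔ z ∈ [t, u, v, w] ∨ z = s := by
      intro z
      simp only [List.mem_cons, List.not_mem_nil, or_false]
      tauto
    have hR₁ : ∀ p ∈ insert [t, u, s, v, w] (R'.erase [t, u, v, w]), p.length = 4 → p ∈ R' := by
      intro p hp hlen
      rcases Finset.mem_insert.1 hp with rfl | hp
      · simp at hlen
      · exact Finset.mem_of_mem_erase hp
    refine ⟨i, [], insert [t, u, s, v, w] (R'.erase [t, u, v, w]),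
      ⟨h.adj, h.isSpider.trim, hdisj, ?_, ?_, fun p hp hlen => h.subset p (hR₁ p hp hlen) hlen,
      by simp, h.inner'⟩, by simp, hR₁⟩
    · refine (h.isRest.erase hp (fun v => Iff.rfl)).insert ⟨?_, ?_, by simp⟩ ?_ ?_ ?_ ?_
      · have := hlong.chain
        simp only [List.isChain_cons_cons] at this ⊢
        exact ⟨this.1, hu.symm, hv, this.2.2⟩
      · have := hlong.nodup
        grind
      · exact fun z hz => Or.inl (hsub z hz)
      · intro z hz
        rcases (hmem z).1 hz with hz | rfl
        exacts [Or.inr hz, Or.inl hsR]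
      · intro z hz hz'
        rcases (hmem z).1 hz with hz | rfl
        exacts [h.isRest.disjoint z (hsub z hz') _ hp hz, hsW hz']
      · rintro b - (hb | hb)
        · exact (hcase b hb).imp id fun hb => (hmem b).2 (Or.inr hb)
        · exact Or.inr ((hmem b).2 (Or.inl hb))
    · refine lt_of_le_of_lt (Finset.card_insert_le _ _) ?_
      rw [Finset.card_erase_add_one hp]
      exact h.card
  · refine ⟨i, [], R', ⟨h.adj, h.isSpider.trim, hdisj, h.isRest.mono hsub ?_, h.card, h.subset,
      by simp, h.inner'⟩, by simp, fun p hp _ => hp⟩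
    intro b hb hbW
    rcases hcase b hbW with h | rfl
    exacts [h, absurd hb hsB]

end growth

/-- A bouquet with outer vertices in `B`, and a path system `R` covering the rest of `B`. -/
structure IsConfiguration (G : SimpleGraph V) (B : Finset V) (T : Finset V)
    (S : Finset (V × List V)) (W : Set V) (R : Finset (List V)) : Prop
    extends G.IsBouquet T S W where
  isRest : G.IsRest B W R
  outer_mem : ∀ x ∈ S, x.1 ∈ B
  notInsertable : ∀ x ∈ S, x.2 ≠ [] → G.NotInsertable R x.1

section configuration

variable {B T : Finset V} {S : Finset (V × List V)} {W : Set V} {R R' : Finset (List V)}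
  {x : V × List V} {c s s' : V} {r r' : List V}

theorem IsConfiguration.exists_tiles_of_tiles [DecidableEq V] (h : G.IsConfiguration B T S W R)
    (hx : x ∈ S) {p : List V} (hp : p ∈ R) (ht : G.Tiles {v | v ∈ p ∨ v ∈ x.1 :: x.2}) :
    ∃ U, G.Tiles U ∧ ∀ b ∈ B, b ∈ U := by
  refine (h.isRest.erase hp (fun v => Iff.rfl)).tiles (W := W ∪ {v | v ∈ p}) ?_
  refine (h.tiles x hx).union ht ?_ fun v => ?_
  · rintro v ⟨hvW, hvx⟩ (hv | hv)
    exacts [h.isRest.disjoint v hvW p hp hv, hvx hv]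
  · have := h.mem_of_mem_leg hx (v := v)
    simp only [Set.mem_union, Set.mem_ofPred_eq]
    tauto

theorem IsConfiguration.exists_isGrowth [DecidableEq V] (h : G.IsConfiguration B T S W R)
    (hN : ¬ ∃ U, G.Tiles U ∧ ∀ b ∈ B, b ∈ U) (hx : x ∈ S) {p : List V} (hp : p ∈ R) {y : V}
    (hy : y ∈ p) (hxy : G.Adj x.1 y) :
    ∃ s r s' r' R', G.IsGrowth B W R x.1 y s r s' r' R' := by
  have hno : ¬ G.Tiles {v | v ∈ p ∨ v ∈ x.1 :: x.2} :=
    fun ht => hN (h.exists_tiles_of_tiles hx hp ht)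
  have hlong := h.isRest.isPathSystem.isLongPath p hp
  have hd : ∀ v ∈ x.1 :: x.2, v ∉ p :=
    fun v hv => h.isRest.disjoint v (h.mem_of_mem_leg hx hv) p hp
  have hxc := h.chain x hx
  have hxn := h.nodup x hx
  obtain ⟨l₁, l₂, rfl⟩ := List.append_of_mem hy
  have hrev : (l₁ ++ y :: l₂).reverse = l₂.reverse ++ y :: l₁.reverse := by simp
  have h₁ : ¬ (l₁ = [] ∨ 3 ≤ l₁.length ∧ l₂ ≠ []) :=
    fun hl => hno (tiles_attach hlong hxc hxn hd hxy hl)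
  have h₂ : ¬ (l₂.reverse = [] ∨ 3 ≤ l₂.reverse.length ∧ l₁.reverse ≠ []) := by
    intro hl
    have := tiles_attach (hrev ▸ hlong.reverse) hxc hxn
      (fun v hv => by rw [← hrev, List.mem_reverse]; exact hd v hv) hxy hl
    simp only [← hrev, List.mem_reverse] at this
    exact hno this
  have hA : l₁ ≠ [] := fun h => h₁ (Or.inl h)
  have hA' : l₂.reverse ≠ [] := fun h => h₂ (Or.inl h)
  have hlen : l₁.length ≤ 2 := by
    by_contra hlen
    exact h₁ (Or.inr ⟨by lia, by simpa using hA'⟩)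
  have hlen' : l₂.reverse.length ≤ 2 := by
    by_contra hlen
    exact h₂ (Or.inr ⟨by lia, by simpa using hA⟩)
  obtain ⟨s, r, rfl⟩ := List.exists_cons_of_ne_nil hA
  obtain ⟨s', r', hl₂⟩ := List.exists_cons_of_ne_nil hA'
  have hmem : ∀ v, v ∈ s :: r ++ y :: s' :: r' ↔ v ∈ s :: r ++ y :: l₂ := by
    intro v
    rw [← hl₂]
    simp
  have hmem' : ∀ v, v ∈ s' :: r' ++ y :: s :: r ↔ v ∈ s :: r ++ y :: l₂ := by
    intro v
    rw [← hmem]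
    simp only [List.mem_append, List.mem_cons]
    tauto
  have hsp : G.IsSpider y s r s' r' := by
    have hc := List.isChain_split.1 hlong.chain
    refine ⟨hc.1, ?_, ?_, by simpa using hlen, by rw [hl₂] at hlen'; simpa using hlen'⟩
    · rw [← isChain_reverse_adj, ← hl₂]
      simpa using hc.2
    · rw [← hl₂]
      exact ((((List.reverse_perm _).cons y).append_left (s :: r)).nodup_iff).2 hlong.nodup
  refine ⟨s, r, s', r', R.erase (s :: r ++ y :: l₂), hxy, hsp, ?_, ?_, ?_, ?_, ?_, ?_⟩
  · exact fun v hv hvW => h.isRest.disjoint v hvW _ hp ((hmem v).1 hv)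
  · exact h.isRest.erase hp fun v => by simp only [Set.mem_union, Set.mem_ofPred_eq, hmem]
  · exact Finset.card_erase_lt_of_mem hp
  · exact fun q hq _ => Finset.mem_of_mem_erase hq
  · intro v hv hxv
    obtain rfl : r = [v] := by
      match r, hsp.length with
      | [w], _ =>
        obtain rfl : v = w := by simpa using hv
        rfl
    refine hno ?_
    have := hsp.tiles_of_adj_inner hxc hxn (fun w hw hw' => hd w hw ((hmem w).1 hw')) hxy hxv ?_
    · simpa only [← hmem] using this
    · rintro rfl
      by_contra hx2
      obtain rfl : l₂ = [s'] := by simpa using congrArg List.reverse hl₂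
      exact h.notInsertable x hx hx2 s v y s' hp hxv hxy
  · intro v hv hxv
    obtain rfl : r' = [v] := by
      match r', hsp.length' with
      | [w], _ =>
        obtain rfl : v = w := by simpa using hv
        rfl
    refine hno ?_
    have := hsp.symm.tiles_of_adj_inner hxc hxn (fun w hw hw' => hd w hw ((hmem' w).1 hw')) hxy
      hxv ?_
    · simpa only [← hmem'] using this
    · rintro rfl
      by_contra hx2
      obtain rfl : l₂ = [v, s'] := by simpa using congrArg List.reverse hl₂
      exact h.notInsertable x hx hx2 s y v s' hp hxy hxv

theorem IsConfiguration.outer_mem_of_isGrowth (h : G.IsConfiguration B T S W R)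
    (hN : ¬ ∃ U, G.Tiles U ∧ ∀ b ∈ B, b ∈ U) (hx : x ∈ S)
    (hg : G.IsGrowth B W R x.1 c s r s' r' R') (hr : r ≠ [] → s ∈ B) : s ∈ B := by
  by_contra hs
  obtain rfl : r = [] := by
    by_contra hr'
    exact hs (hr hr')
  have hg' := hg.symm
  have ht := (h.tilesFrom_new hx hg.adj hg'.isSpider hg'.disjoint (fun v => Iff.rfl)).tiles
  refine hN (IsRest.tiles (W := {v | v ∈ W ∪ {v | v ∈ s' :: r' ++ [c, s]} ∧ v ∉ [s]})
    (hg'.isRest.mono (fun v hv => hv.1) fun b hb hbW => ⟨hbW, ?_⟩) ht)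
  simp only [List.mem_singleton]
  rintro rfl
  exact hs hb

theorem IsConfiguration.exists_extend [DecidableEq V] (h : G.IsConfiguration B T S W R)
    (hN : ¬ ∃ U, G.Tiles U ∧ ∀ b ∈ B, b ∈ U) (hx : x ∈ S) {p : List V} (hp : p ∈ R) {y : V}
    (hy : y ∈ p) (hxy : G.Adj x.1 y) :
    ∃ T' S' W' R', G.IsConfiguration B T' S' W' R' ∧ R'.card < R.card := by
  obtain ⟨s₀, r₀, s₁, r₁, R₀, hg⟩ := h.exists_isGrowth hN hx hp hy hxy
  obtain ⟨s, r, R₁, hg, hr, -⟩ := hg.exists_trim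
  obtain ⟨s', r', R₂, hg, hr', hR₂⟩ := hg.symm.exists_trim
  have hr₂ : r ≠ [] → s ∈ B ∧ G.NotInsertable R₂ s := fun h => ⟨(hr h).1, (hr h).2.mono hR₂⟩
  refine ⟨_, _, _, R₂, ⟨h.extend hx hxy hg.isSpider hg.disjoint (fun v => Iff.rfl) hg.inner
    hg.inner' fun ht => hN (hg.isRest.tiles ht), hg.isRest, ?_, ?_⟩, hg.card⟩
  · simp only [Finset.forall_mem_insert]
    exact ⟨h.outer_mem_of_isGrowth hN hx hg fun h => (hr' h).1,
      h.outer_mem_of_isGrowth hN hx hg.symm fun h => (hr₂ h).1, h.outer_mem⟩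
  · simp only [Finset.forall_mem_insert]
    exact ⟨fun h => (hr' h).2, fun h => (hr₂ h).2,
      fun z hz hz' => (h.notInsertable z hz hz').mono hg.subset⟩

theorem IsConfiguration.exists_tiles_of_uncovered (h : G.IsConfiguration B T S W R)
    (hx : x ∈ S) {y z : V} (hy : G.Adj x.1 y) (hz : G.Adj x.1 z) (hyz : y ≠ z)
    (hleg : ∀ v ∈ x.2, v = y ∨ v = z) (hW : ∀ v, v = y ∨ v = z → v ∈ W → v ∈ x.2)
    (hR : ∀ v, v = y ∨ v = z → ∀ p ∈ R, v ∉ p) : ∃ U, G.Tiles U ∧ ∀ b ∈ B, b ∈ U := by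
  have hxW : x.1 ∈ W := h.mem_of_mem_leg hx (by simp)
  have hmem : ∀ v, v ∈ [y, x.1, z] ↔ v = x.1 ∨ v = y ∨ v = z := by
    intro v
    simp only [List.mem_cons, List.not_mem_nil, or_false]
    tauto
  have hrest : G.IsRest B (W ∪ {v | v ∈ [y, x.1, z]}) R := by
    refine ⟨h.isRest.isPathSystem, ?_, fun b hb => (h.isRest.cover b hb).imp Or.inl id⟩
    rintro v (hv | hv)
    · exact h.isRest.disjoint v hv
    · rcases (hmem v).1 hv with rfl | hv
      exacts [h.isRest.disjoint _ hxW, hR v hv]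
  refine hrest.tiles ((h.tiles x hx).add_path (p := [y, x.1, z]) ⟨?_, ?_, by simp⟩ ?_ fun v => ?_)
  · simp [hy.symm, hz]
  · simp [hy.symm.ne, hz.ne, hyz]
  · intro v hv hv'
    rcases (hmem v).1 hv with rfl | hv
    · exact hv'.2 (by simp)
    · exact hv'.2 (List.mem_cons_of_mem _ (hW v hv hv'.1))
  · have := hleg v
    simp only [Set.mem_union, Set.mem_ofPred_eq, hmem, List.mem_cons]
    by_cases hv : v ∈ x.2 <;> tauto

theorem IsConfiguration.card_neighbors_le_one [Fintype V] [DecidableEq V] [DecidableRel G.Adj]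
    (h : G.IsConfiguration B T S W R) (hN : ¬ ∃ U, G.Tiles U ∧ ∀ b ∈ B, b ∈ U)
    (hR : ∀ p ∈ R, ∀ y ∈ p, ¬ G.Adj x.1 y) (hx : x ∈ S) :
    (G.neighborFinset x.1 \ T).card ≤ 1 := by
  have hW : ∀ y, G.Adj x.1 y → y ∉ T → y ∈ W → y ∈ x.2 := by
    intro y hy hyT hyW
    rcases (h.mem_iff y).1 hyW with h' | ⟨z, hz, hyz⟩
    · exact absurd h' hyT
    · by_cases hxz : x = z
      · subst hxz
        exact (List.mem_cons.1 hyz).resolve_left hy.ne'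
      · exact absurd hy (h.not_adj x hx z hz hxz y hyz)
  rw [Finset.card_le_one]
  intro y hy z hz
  simp only [Finset.mem_sdiff, mem_neighborFinset] at hy hz
  by_contra hyz
  have hlen := h.length x hx
  have key : ∀ i, x.2 = [i] → ∀ u, G.Adj x.1 u → u ∉ T → u = i := by
    intro i hi u hu huT
    by_contra hui
    have hxi : G.Adj x.1 i := by
      have := h.chain x hx
      rw [hi] at this
      simpa using this
    refine hN (h.exists_tiles_of_uncovered hx hu hxi hui (by simp [hi]) ?_ ?_)
    · rintro v (rfl | rfl) hv
      · exact hW _ hu huT hv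
      · simp [hi]
    · rintro v (rfl | rfl) p hp hvp
      exacts [hR p hp _ hvp hu, hR p hp _ hvp hxi]
  by_cases hx2 : x.2 = []
  · refine hN (h.exists_tiles_of_uncovered hx hy.1 hz.1 hyz (by simp [hx2]) ?_ ?_)
    · rintro v (rfl | rfl) hv
      exacts [hW _ hy.1 hy.2 hv, hW _ hz.1 hz.2 hv]
    · rintro v (rfl | rfl) p hp hvp
      exacts [hR p hp _ hvp hy.1, hR p hp _ hvp hz.1]
  · obtain ⟨i, hi⟩ := List.length_eq_one_iff.1
      (le_antisymm hlen (List.length_pos_of_ne_nil hx2))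
    exact hyz ((key i hi y hy.1 hy.2).trans (key i hi z hz.1 hz.2).symm)

theorem IsConfiguration.exists_adj [Fintype V] [DecidableEq V] [DecidableRel G.Adj]
    (h : G.IsConfiguration B T S W R) (hN : ¬ ∃ U, G.Tiles U ∧ ∀ b ∈ B, b ∈ U)
    (hB : ∀ b ∈ B, G.maxDegree + 2 ≤ 2 * G.degree b) :
    ∃ x ∈ S, ∃ p ∈ R, ∃ y ∈ p, G.Adj x.1 y := by
  by_contra! hR
  have hinj : Set.InjOn Prod.fst (S : Set (V × List V)) := by
    intro x hx y hy hxy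
    by_contra hne
    exact h.disjoint x hx y hy hne x.1 (by simp) (by simp [hxy])
  have hlow : ∀ x ∈ S, G.maxDegree ≤ 2 * (T.filter fun t => G.Adj x.1 t).card := by
    intro x hx
    have h1 := h.card_neighbors_le_one hN (hR x hx) hx
    have h2 := hB x.1 (h.outer_mem x hx)
    have h3 := Finset.card_inter_add_card_sdiff (G.neighborFinset x.1) T
    have h4 : G.neighborFinset x.1 ∩ T = T.filter fun t => G.Adj x.1 t := by
      ext
      simp [and_comm]
    rw [h4, card_neighborFinset_eq_degree] at h3
    lia
  have hup : ∀ t ∈ T, (S.filter fun x => G.Adj x.1 t).card ≤ G.maxDegree := by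
    intro t _
    refine le_trans ?_ (G.degree_le_maxDegree t)
    rw [← card_neighborFinset_eq_degree]
    refine Finset.card_le_card_of_injOn Prod.fst ?_
      (hinj.mono (by exact_mod_cast Finset.filter_subset _ S))
    intro x hx
    simp only [Finset.coe_filter, Set.mem_ofPred_eq] at hx
    simpa using hx.2.symm
  have hcount := Finset.sum_card_bipartiteAbove_eq_sum_card_bipartiteBelow
    (s := S) (t := T) fun x t => G.Adj x.1 t
  have h1 := Finset.sum_le_sum hlow
  have h2 := Finset.sum_le_sum hup
  simp only [Finset.bipartiteAbove, Finset.bipartiteBelow] at hcount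
  rw [← Finset.mul_sum, hcount, Finset.sum_const, smul_eq_mul, h.card] at h1
  rw [Finset.sum_const, smul_eq_mul] at h2
  obtain ⟨x, hx⟩ : S.Nonempty := by
    rw [← Finset.card_pos, h.card]
    lia
  have h3 := hB x.1 (h.outer_mem x hx)
  have h4 := G.degree_le_maxDegree x.1
  nlinarith

theorem IsConfiguration.exists_tiles [Fintype V] [DecidableEq V] [DecidableRel G.Adj]
    (h : G.IsConfiguration B T S W R) (hB : ∀ b ∈ B, G.maxDegree + 2 ≤ 2 * G.degree b) :
    ∃ U, G.Tiles U ∧ ∀ b ∈ B, b ∈ U := by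
  by_contra hN
  induction hn : R.card using Nat.strong_induction_on generalizing T S W R with
  | _ n ih =>
    obtain ⟨x, hx, p, hp, y, hy, hxy⟩ := h.exists_adj hN hB
    obtain ⟨T', S', W', R', h', hlt⟩ := h.exists_extend hN hx hp hy hxy
    exact ih _ (hn ▸ hlt) h' rfl

end configuration

/-- The vertices of degree more than `(Δ + 1) / 2` are covered by disjoint paths on at least
three vertices. -/
theorem exists_tiles_of_maxDegree_lt [Fintype V] [DecidableEq V] [DecidableRel G.Adj] (B : Finset V)
    (hB : ∀ b ∈ B, G.maxDegree + 2 ≤ 2 * G.degree b) : ∃ U, G.Tiles U ∧ ∀ b ∈ B, b ∈ U := by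
  induction B using Finset.induction with
  | empty => exact ⟨∅, tiles_empty, by simp⟩
  | insert a B _ ih =>
    obtain ⟨U, ⟨R, hR, hUR⟩, hU⟩ := ih fun b hb => hB b (Finset.mem_insert_of_mem hb)
    by_cases ha : a ∈ U
    · exact ⟨U, ⟨R, hR, hUR⟩, by simpa [ha] using hU⟩
    · have hbouquet : G.IsBouquet ∅ {(a, [])} {a} := by
        constructor <;> simp
        exact tiles_empty
      refine IsConfiguration.exists_tiles (T := ∅) (S := {(a, [])}) (W := {a}) (R := R)
        ⟨hbouquet, ⟨hR, ?_, ?_⟩, by simp, by simp⟩ hB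
      · rintro v rfl p hp hv
        exact ha ((hUR v).2 ⟨p, hp, hv⟩)
      · intro b hb
        exact (Finset.mem_insert.1 hb).imp id fun hb => (hUR b).1 (hU b hb)

section unionPaths

variable {R : Finset (List V)}

/-- Long paths can be split, so that all paths have at most five vertices. -/
theorem IsPathSystem.exists_short (h : G.IsPathSystem R) :
    ∃ R', G.IsPathSystem R' ∧ (∀ p ∈ R', p.length ≤ 5) ∧
      ∀ v, (∃ p ∈ R', v ∈ p) ↔ ∃ p ∈ R, v ∈ p := by
  classical
  induction hn : ∑ p ∈ R, (p.length - 5) using Nat.strong_induction_on generalizing R with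
  | _ n ih =>
    by_cases hR : ∀ p ∈ R, p.length ≤ 5
    · exact ⟨R, h, hR, fun _ => Iff.rfl⟩
    push Not at hR
    obtain ⟨p, hp, hlen⟩ := hR
    have hlong := h.isLongPath p hp
    obtain ⟨l₁, l₂, hl, hlen₁⟩ : ∃ l₁ l₂, p = l₁ ++ l₂ ∧ l₁.length = 3 :=
      ⟨p.take 3, p.drop 3, by simp, by simp; lia⟩
    have hlen₂ : p.length = 3 + l₂.length := by rw [hl, List.length_append, hlen₁]
    have hmem : ∀ v, v ∈ p ↔ v ∈ l₁ ∨ v ∈ l₂ := by simp [hl]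
    have hchain := hlong.chain
    have hnodup := hlong.nodup
    rw [hl, List.isChain_append] at hchain
    rw [hl, List.nodup_append] at hnodup
    have hdisj : ∀ v ∈ l₂, v ∉ l₁ := fun v hv hv' => hnodup.2.2 v hv' v hv rfl
    have hrest : G.IsRest ∅ ∅ R := ⟨h, by simp, by simp⟩
    have hrest := ((hrest.erase hp (W' := {v | v ∈ p}) (by simp)).insert (W' := {v | v ∈ l₁})
      (p := l₂) ⟨hchain.2.1, hnodup.2.1, by lia⟩ (fun v hv => (hmem v).2 (Or.inl hv))
      (fun v hv => (hmem v).2 (Or.inr hv)) hdisj (by simp)).insert (W' := ∅) (p := l₁)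
      ⟨hchain.1, hnodup.1, by lia⟩ (by simp) (fun v hv => hv) (by simp) (by simp)
    have hnot : ∀ l, l ≠ [] → (∀ v ∈ l, v ∈ p) → l ∉ R.erase p := by
      intro l hl₀ hlp hlR
      obtain ⟨v, hv⟩ := List.exists_mem_of_ne_nil l hl₀
      exact h.disjoint l (Finset.mem_of_mem_erase hlR) p hp (Finset.ne_of_mem_erase hlR) v hv
        (hlp v hv)
    have h₂ : l₂ ∉ R.erase p :=
      hnot l₂ (by rintro rfl; simp at hlen₂; lia) fun v hv => (hmem v).2 (Or.inr hv)
    have h₁ : l₁ ∉ insert l₂ (R.erase p) := by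
      intro hc
      have hl₁ : l₁ ≠ [] := by
        rintro rfl
        simp at hlen₁
      rcases Finset.mem_insert.1 hc with hc | hc
      · obtain ⟨v, hv⟩ := List.exists_mem_of_ne_nil l₁ hl₁
        exact hdisj v (hc ▸ hv) hv
      · exact hnot l₁ hl₁ (fun v hv => (hmem v).2 (Or.inl hv)) hc
    obtain ⟨R', hR', hshort, hcov⟩ := ih (∑ p ∈ insert l₁ (insert l₂ (R.erase p)), (p.length - 5))
      (by
        rw [← hn, Finset.sum_insert h₁, Finset.sum_insert h₂,
          ← Finset.add_sum_erase R (fun p => p.length - 5) hp]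
        lia) hrest.isPathSystem rfl
    refine ⟨R', hR', hshort, fun v => ?_⟩
    rw [hcov]
    simp only [Finset.exists_mem_insert]
    constructor
    · rintro (hv | hv | ⟨q, hq, hv⟩)
      exacts [⟨p, hp, (hmem v).2 (Or.inl hv)⟩, ⟨p, hp, (hmem v).2 (Or.inr hv)⟩,
        ⟨q, Finset.mem_of_mem_erase hq, hv⟩]
    · rintro ⟨q, hq, hv⟩
      by_cases hqp : q = p
      · rw [hqp, hmem] at hv
        exact hv.imp id Or.inl
      · exact Or.inr (Or.inr ⟨q, Finset.mem_erase.2 ⟨hqp, hq⟩, hv⟩)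

/-- A path system covering the vertices of degree more than `(Δ + 1) / 2`, with a maximal set of
covered vertices. -/
theorem exists_maximal_isPathSystem [Fintype V] (G : SimpleGraph V) [DecidableRel G.Adj] :
    ∃ R, G.IsPathSystem R ∧ (∀ b, G.maxDegree + 2 ≤ 2 * G.degree b → ∃ p ∈ R, b ∈ p) ∧
      ∀ R', G.IsPathSystem R' → (∀ v, (∃ p ∈ R, v ∈ p) → ∃ p ∈ R', v ∈ p) →
        ∀ v, (∃ p ∈ R', v ∈ p) → ∃ p ∈ R, v ∈ p := by
  classical
  obtain ⟨U, hU, hBU⟩ := G.exists_tiles_of_maxDegree_lt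
    (Finset.univ.filter fun b => G.maxDegree + 2 ≤ 2 * G.degree b) (by simp)
  obtain ⟨M, hUM, hM⟩ := (Set.toFinite {U | G.Tiles U}).exists_le_maximal hU
  obtain ⟨R, hR, hcov⟩ := hM.prop
  refine ⟨R, hR, fun b hb => (hcov b).1 (hUM (hBU b (by simpa using hb))), ?_⟩
  intro R' hR' hsub v hv
  have := hM.le_of_ge (y := {v | ∃ p ∈ R', v ∈ p}) ⟨R', hR', fun _ => Iff.rfl⟩
    fun x hx => hsub x ((hcov x).1 hx)
  exact (hcov v).1 (this hv)

/-- The graph formed by the edges of the paths in `R`. -/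
def unionPaths (R : Finset (List V)) : SimpleGraph V :=
  fromRel fun u v => ∃ p ∈ R, ∃ (i : ℕ) (h : i + 1 < p.length), p[i] = u ∧ p[i + 1] = v

theorem IsPathSystem.unionPaths_le (h : G.IsPathSystem R) : unionPaths R ≤ G := by
  have key : ∀ u v, (∃ p ∈ R, ∃ (i : ℕ) (h : i + 1 < p.length), p[i] = u ∧ p[i + 1] = v) →
      G.Adj u v := by
    rintro u v ⟨p, hp, i, hi, rfl, rfl⟩
    exact (h.isLongPath p hp).chain.getElem i hi
  rintro u v ⟨-, huv | huv⟩
  exacts [key u v huv, (key v u huv).symm]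

theorem IsPathSystem.eq_of_mem (h : G.IsPathSystem R) {p q : List V} (hp : p ∈ R) (hq : q ∈ R)
    {v : V} (hvp : v ∈ p) (hvq : v ∈ q) : p = q := by
  by_contra hpq
  exact h.disjoint p hp q hq hpq v hvp hvq

theorem IsPathSystem.unionPaths_adj_getElem (h : G.IsPathSystem R) {p : List V} (hp : p ∈ R)
    {i j : ℕ} (hi : i < p.length) (hj : j < p.length) :
    (unionPaths R).Adj p[i] p[j] ↔ i + 1 = j ∨ j + 1 = i := by
  have hn := (h.isLongPath p hp).nodup
  have key : ∀ {i j : ℕ} (hi : i < p.length) (hj : j < p.length),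
      (∃ q ∈ R, ∃ (k : ℕ) (h : k + 1 < q.length), q[k] = p[i] ∧ q[k + 1] = p[j]) ↔ i + 1 = j := by
    intro i j hi hj
    constructor
    · rintro ⟨q, hq, k, hk, hki, hkj⟩
      obtain rfl : p = q := h.eq_of_mem hp hq (List.getElem_mem hi) (hki ▸ List.getElem_mem _)
      rw [hn.getElem_inj_iff] at hki hkj
      lia
    · rintro rfl
      exact ⟨p, hp, i, hj, rfl, rfl⟩
  rw [unionPaths, fromRel_adj, key hi hj, key hj hi, Ne, hn.getElem_inj_iff]
  lia

theorem exists_mem_of_unionPaths_adj {u v : V} (huv : (unionPaths R).Adj u v) :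
    ∃ p ∈ R, u ∈ p ∧ v ∈ p := by
  rcases huv with ⟨-, ⟨p, hp, i, hi, rfl, rfl⟩ | ⟨p, hp, i, hi, rfl, rfl⟩⟩
  exacts [⟨p, hp, List.getElem_mem _, List.getElem_mem _⟩,
    ⟨p, hp, List.getElem_mem _, List.getElem_mem _⟩]

theorem IsPathSystem.mem_support_unionPaths (h : G.IsPathSystem R) {v : V} :
    v ∈ (unionPaths R).support ↔ ∃ p ∈ R, v ∈ p := by
  constructor
  · rintro ⟨w, hw⟩
    obtain ⟨p, hp, hv, -⟩ := exists_mem_of_unionPaths_adj hw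
    exact ⟨p, hp, hv⟩
  · rintro ⟨p, hp, hv⟩
    obtain ⟨i, hi, rfl⟩ := List.mem_iff_getElem.1 hv
    have hlen := (h.isLongPath p hp).length
    rcases i with - | i
    · exact ⟨p[1], (h.unionPaths_adj_getElem hp hi (by lia)).2 (by lia)⟩
    · exact ⟨p[i], (h.unionPaths_adj_getElem hp hi (by lia)).2 (by lia)⟩

theorem IsPathSystem.reachable_unionPaths_iff (h : G.IsPathSystem R) {p : List V} (hp : p ∈ R)
    {u v : V} (hu : u ∈ p) : (unionPaths R).Reachable u v ↔ v ∈ p := by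
  constructor
  · rintro ⟨w⟩
    induction w with
    | nil => exact hu
    | cons hadj _ ih =>
      obtain ⟨q, hq, h₁, h₂⟩ := exists_mem_of_unionPaths_adj hadj
      obtain rfl := h.eq_of_mem hp hq hu h₁
      exact ih h₂
  · intro hv
    have hlen := (h.isLongPath p hp).length
    have key : ∀ (i : ℕ) (hi : i < p.length), (unionPaths R).Reachable p[0] p[i] := by
      intro i
      induction i with
      | zero => exact fun _ => Reachable.refl _
      | succ i ih =>
        intro hi
        exact (ih (by lia)).trans ((h.unionPaths_adj_getElem hp (by lia) hi).2
          (Or.inl rfl)).reachable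
    obtain ⟨i, hi, rfl⟩ := List.mem_iff_getElem.1 hu
    obtain ⟨j, hj, rfl⟩ := List.mem_iff_getElem.1 hv
    exact (key i hi).symm.trans (key j hj)

theorem IsPathSystem.isPathOn_of_supp_eq (h : G.IsPathSystem R) {p : List V} (hp : p ∈ R)
    {s : Set V} (hs : ∀ v, v ∈ s ↔ v ∈ p) : IsPathOn ((unionPaths R).induce s) p.length := by
  have hn := (h.isLongPath p hp).nodup
  let f : Fin p.length → s := fun i => ⟨p[i], (hs _).2 (List.getElem_mem _)⟩
  have hf : Function.Bijective f := by
    constructor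
    · intro i j hij
      exact Fin.ext ((hn.getElem_inj_iff).1 (congrArg Subtype.val hij))
    · rintro ⟨v, hv⟩
      obtain ⟨i, hi, rfl⟩ := List.mem_iff_getElem.1 ((hs v).1 hv)
      exact ⟨⟨i, hi⟩, rfl⟩
  refine ⟨Iso.symm ⟨Equiv.ofBijective f hf, ?_⟩⟩
  intro i j
  rw [pathGraph_adj]
  exact h.unionPaths_adj_getElem hp i.2 j.2

theorem IsPathSystem.exists_isPathOn (h : G.IsPathSystem R)
    (c : (unionPaths R).ConnectedComponent) (hc : c.supp.Nontrivial) :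
    ∃ p ∈ R, IsPathOn ((unionPaths R).induce c.supp) p.length := by
  obtain ⟨u, hu, v, hv, huv⟩ := hc
  have hreach : (unionPaths R).Reachable u v := ConnectedComponent.exact (hu.trans hv.symm)
  obtain ⟨p, hp, hup⟩ : ∃ p ∈ R, u ∈ p := by
    obtain ⟨w⟩ := hreach
    cases w with
    | nil => exact absurd rfl huv
    | cons hadj _ => exact h.mem_support_unionPaths.1 ⟨_, hadj⟩
  refine ⟨p, hp, h.isPathOn_of_supp_eq hp fun w => ?_⟩
  rw [← h.reachable_unionPaths_iff hp hup, ← hu, ConnectedComponent.mem_supp_iff,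
    ConnectedComponent.eq]
  exact ⟨Reachable.symm, Reachable.symm⟩

theorem IsPathSystem.ncard_neighborSet (h : G.IsPathSystem R) {p : List V} (hp : p ∈ R) {i : ℕ}
    (hi : i + 2 < p.length) : ((unionPaths R).neighborSet p[i + 1]).ncard = 2 := by
  have hn := (h.isLongPath p hp).nodup
  have : (unionPaths R).neighborSet p[i + 1] = {p[i], p[i + 2]} := by
    ext v
    simp only [mem_neighborSet, Set.mem_insert_iff, Set.mem_singleton_iff]
    constructor
    · intro hv
      have hvp := (h.reachable_unionPaths_iff hp (List.getElem_mem _)).1 hv.reachable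
      obtain ⟨j, hj, rfl⟩ := List.mem_iff_getElem.1 hvp
      rw [h.unionPaths_adj_getElem hp] at hv
      rw [hn.getElem_inj_iff, hn.getElem_inj_iff]
      lia
    · rintro (rfl | rfl) <;> rw [h.unionPaths_adj_getElem hp] <;> lia
  rw [this, Set.ncard_pair]
  rw [Ne, hn.getElem_inj_iff]
  lia

end unionPaths

end SimpleGraph

/-- Lemma 6: every graph `G` has a linear forest `F` (a subgraph, with vertex set
`F.support`) such that: (1) each component of `F` is a path on 3, 4 or 5 vertices;
(2) `G − V(F)` consists of isolated vertices and isolated edges, and each vertex outside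
`V(F)` has degree at most `(Δ(G)+1)/2` in `G`; (3) every neighbor in `V(F)` of a vertex
outside `V(F)` has degree 2 in `F`. -/
theorem exists_short_path_forest {V : Type*} [Fintype V]
    (G : SimpleGraph V) [DecidableRel G.Adj] :
    ∃ F : SimpleGraph V, F ≤ G ∧
      (∀ c : F.ConnectedComponent, (c.supp).Nontrivial →
        IsPathOn (F.induce c.supp) 3 ∨ IsPathOn (F.induce c.supp) 4 ∨
          IsPathOn (F.induce c.supp) 5) ∧
      (∀ u v w : V, u ∉ F.support → v ∉ F.support → w ∉ F.support →
        G.Adj u v → G.Adj u w → v = w) ∧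
      (∀ v : V, v ∉ F.support → 2 * G.degree v ≤ G.maxDegree + 1) ∧
      (∀ v : V, v ∉ F.support → ∀ u : V, G.Adj v u → u ∈ F.support →
        (F.neighborSet u).ncard = 2) := by
  classical
  obtain ⟨R, hR, hB, hmax⟩ := G.exists_maximal_isPathSystem
  obtain ⟨R, hR, hB, hshort, hmax⟩ : ∃ R, G.IsPathSystem R ∧
      (∀ b, G.maxDegree + 2 ≤ 2 * G.degree b → ∃ p ∈ R, b ∈ p) ∧ (∀ p ∈ R, p.length ≤ 5) ∧
      ∀ R', G.IsPathSystem R' → (∀ v, (∃ p ∈ R, v ∈ p) → ∃ p ∈ R', v ∈ p) →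
        ∀ v, (∃ p ∈ R', v ∈ p) → ∃ p ∈ R, v ∈ p := by
    obtain ⟨R₁, hR₁, hshort, hcov⟩ := hR.exists_short
    exact ⟨R₁, hR₁, fun b hb => (hcov b).2 (hB b hb), hshort, by simpa only [hcov] using hmax⟩
  refine ⟨SimpleGraph.unionPaths R, hR.unionPaths_le, ?_, ?_, ?_, ?_⟩
  · intro c hc
    obtain ⟨p, hp, hpath⟩ := hR.exists_isPathOn c hc
    have h₁ := hshort p hp
    have h₂ := (hR.isLongPath p hp).length
    obtain h | h | h : p.length = 3 ∨ p.length = 4 ∨ p.length = 5 := by lia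
    · exact Or.inl (h ▸ hpath)
    · exact Or.inr (Or.inl (h ▸ hpath))
    · exact Or.inr (Or.inr (h ▸ hpath))
  · intro u v w hu hv hw huv huw
    rw [hR.mem_support_unionPaths] at hu hv hw
    by_contra hvw
    have hT : G.Tiles {x | ∃ p ∈ R, x ∈ p} := ⟨R, hR, fun _ => Iff.rfl⟩
    obtain ⟨R', hR', hcov⟩ := hT.add_path (p := [v, u, w])
      ⟨by simp [huv.symm, huw], by simp [huv.ne', huw.ne, hvw], by simp⟩
      (by simp only [List.forall_mem_cons]; exact ⟨hv, hu, hw, by simp⟩) fun x => Iff.rfl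
    exact hu (hmax R' hR' (fun x hx => (hcov x).1 (Or.inl hx)) u
      ((hcov u).1 (Or.inr (by simp))))
  · intro v hv
    rw [hR.mem_support_unionPaths] at hv
    by_contra! hdeg
    exact hv (hB v hdeg)
  · intro v hv u hvu hu
    rw [hR.mem_support_unionPaths] at hv hu
    obtain ⟨p, hp, hup⟩ := hu
    have hlong := hR.isLongPath p hp
    have hend : ∀ l, G.IsLongPath l → (∀ x, x ∈ l ↔ x ∈ p) → ¬ (v :: l).IsChain G.Adj := by
      intro l hl hlp hchain
      have hrest : G.IsRest ∅ ∅ R := ⟨hR, by simp, by simp⟩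
      have hrest := hrest.erase hp (W' := {x | x ∈ p}) (by simp)
      have hT : G.Tiles {x | ∃ q ∈ R.erase p, x ∈ q} :=
        ⟨_, hrest.isPathSystem, fun _ => Iff.rfl⟩
      have hvl : v ∉ l := fun h => hv ⟨p, hp, (hlp v).1 h⟩
      obtain ⟨R', hR', hcov⟩ := hT.add_path (p := v :: l)
        ⟨hchain, List.nodup_cons.2 ⟨hvl, hl.nodup⟩, by have := hl.length; simp; lia⟩
        (by
          rintro x hx ⟨q, hq, hxq⟩
          rcases List.mem_cons.1 hx with rfl | hx
          · exact hv ⟨q, Finset.mem_of_mem_erase hq, hxq⟩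
          · exact hrest.disjoint x ((hlp x).1 hx) q hq hxq) fun x => Iff.rfl
      refine hv (hmax R' hR' ?_ v ((hcov v).1 (Or.inr (by simp))))
      rintro x ⟨q, hq, hxq⟩
      refine (hcov x).1 ?_
      by_cases hqp : q = p
      · exact Or.inr (List.mem_cons_of_mem _ ((hlp x).2 (hqp ▸ hxq)))
      · exact Or.inl ⟨q, Finset.mem_erase.2 ⟨hqp, hq⟩, hxq⟩
    obtain ⟨i, hi, rfl⟩ := List.mem_iff_getElem.1 hup
    rcases i with - | i
    · refine absurd ?_ (hend p hlong fun x => Iff.rfl)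
      obtain ⟨a, l, rfl⟩ := List.exists_cons_of_ne_nil (List.ne_nil_of_mem hup)
      exact List.isChain_cons_cons.2 ⟨hvu, hlong.chain⟩
    · refine hR.ncard_neighborSet hp ?_
      by_contra hi'
      refine absurd ?_ (hend p.reverse hlong.reverse fun x => List.mem_reverse)
      obtain ⟨l, a, rfl⟩ := (List.eq_nil_or_concat' p).resolve_left (List.ne_nil_of_mem hup)
      have hlen : i + 1 = l.length := by
        simp only [List.length_append, List.length_singleton] at hi hi'
        lia
      have hchain := hlong.reverse.chain
      simp only [hlen, List.getElem_concat_length] at hvu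
      rw [List.reverse_append] at hchain ⊢
      exact List.isChain_cons_cons.2 ⟨hvu, hchain⟩
end

section
/- Let P_1, …, P_k be a long path system, i.e., a family of pairwise vertex-disjoint paths each having at least 3 vertices, and let B be a set of pairwise disjoint 2-element subsets of the vertex set of the union of the P_i. Then there exists an edge-3-coloring φ of the disjoint union of P_1, …, P_k such that φ(x) ≠ φ(x') for each pair {x, x'} ∈ B. -/
/-- `φ` is a proper edge-`k`-coloring of `G`: every edge gets a color in `{1,…,k}` and
adjacent (distinct, sharing a vertex) edges get different colors. -/
def IsEdgeKColoring {V : Type*} (G : SimpleGraph V) (k : ℕ) (φ : Sym2 V → ℕ) : Prop :=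
  (∀ e ∈ G.edgeSet, φ e ∈ Finset.Icc 1 k) ∧
  ∀ e₁ ∈ G.edgeSet, ∀ e₂ ∈ G.edgeSet, e₁ ≠ e₂ → (∃ v : V, v ∈ e₁ ∧ v ∈ e₂) → φ e₁ ≠ φ e₂

/-- The color-set of a vertex `v`: the set of colors appearing on edges incident with `v`. -/
def colorSet {V : Type*} (G : SimpleGraph V) (φ : Sym2 V → ℕ) (v : V) : Set ℕ :=
  {c | ∃ e ∈ G.edgeSet, v ∈ e ∧ φ e = c}

/-- A partial matching: every element is related to at most one, different, element. -/
structure IsPartialMatching {J : Type*} (M : J → J → Prop) : Prop where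
  symm : ∀ j k, M j k → M k j
  irrefl : ∀ j, ¬ M j j
  unique : ∀ j k k', M j k → M j k' → k = k'

/-- Remove `A` and `B` from a matching and match their former partners with each other. -/
def rematch {J : Type*} (M : J → J → Prop) (A B : J) (j k : J) : Prop :=
  (M j k ∧ j ≠ A ∧ j ≠ B ∧ k ≠ A ∧ k ≠ B) ∨
    (¬ M A B ∧ ((M A j ∧ M B k) ∨ (M A k ∧ M B j)))

theorem IsPartialMatching.rematch {J : Type*} {M : J → J → Prop} (hM : IsPartialMatching M)
    {A B : J} (hAB : A ≠ B) : IsPartialMatching (rematch M A B) := by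
  obtain ⟨hs, hi, hu⟩ := hM
  refine ⟨?_, ?_, ?_⟩ <;> unfold _root_.rematch <;> grind

theorem matched_of_rematch {J : Type*} {M : J → J → Prop} (hM : IsPartialMatching M)
    {A B j k : J} (h : rematch M A B j k) : ∃ k', M j k' := by
  obtain ⟨hs, hi, hu⟩ := hM
  unfold rematch at h
  grind

/-- `c` is proper on the subgraph induced by `S`, and edges of it matched by `M` have different
color sums. -/
def IsGoodOn {E : Type*} (L : SimpleGraph E) (M : Sym2 E → Sym2 E → Prop) (S : Finset E)
    (c : E → ZMod 3) : Prop :=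
  (∀ a ∈ S, ∀ b ∈ S, L.Adj a b → c a ≠ c b) ∧
  ∀ a ∈ S, ∀ b ∈ S, ∀ a' ∈ S, ∀ b' ∈ S, L.Adj a b → L.Adj a' b' → M s(a, b) s(a', b') →
    c a + c b ≠ c a' + c b'

theorem exists_partner_sum {E : Type*} (L : SimpleGraph E) {M : Sym2 E → Sym2 E → Prop}
    (hM : IsPartialMatching M) (S : Finset E) (c : E → ZMod 3) (j : Sym2 E) :
    ∃ f, ∀ a ∈ S, ∀ b ∈ S, L.Adj a b → M j s(a, b) → c a + c b = f := by
  by_cases h : ∃ a ∈ S, ∃ b ∈ S, L.Adj a b ∧ M j s(a, b)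
  · obtain ⟨a, ha, b, hb, -, hj⟩ := h
    refine ⟨c a + c b, fun a' _ b' _ _ hj' => ?_⟩
    have := hM.unique _ _ _ hj hj'
    rw [Sym2.eq_iff] at this
    grind
  · exact ⟨0, by grind⟩

theorem IsGoodOn.exists_of_erase {E : Type*} [DecidableEq E] {L : SimpleGraph E}
    {M : Sym2 E → Sym2 E → Prop} (hM : IsPartialMatching M) {S : Finset E} {e : E}
    (hone : ∀ a ∈ S, ∀ b ∈ S, L.Adj e a → L.Adj e b → a = b) {c : E → ZMod 3}
    (hc : IsGoodOn L M (S.erase e) c) : ∃ c', IsGoodOn L M S c' := by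
  obtain ⟨hc1, hc2⟩ := hc
  obtain ⟨hs, hi, hu⟩ := id hM
  by_cases h : ∃ g ∈ S, L.Adj e g
  · obtain ⟨g, hg, heg⟩ := h
    have hne := heg.ne
    obtain ⟨f, hf⟩ := exists_partner_sum L hM (S.erase e) c s(e, g)
    obtain ⟨x, hx, hxf⟩ : ∃ x, x ≠ c g ∧ x + c g ≠ f := by
      generalize c g = p
      clear hf
      revert p f; decide
    let c' := Function.update c e x
    have ce : c' e = x := by grind
    have co : ∀ a, a ≠ e → c' a = c a := by grind
    clear_value c'
    have hsplit : ∀ a ∈ S, ∀ b ∈ S, L.Adj a b →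
        (a ∈ S.erase e ∧ b ∈ S.erase e ∧ c' a + c' b = c a + c b) ∨
          (s(a, b) = s(e, g) ∧ c' a + c' b = x + c g) := by
      intro a ha b hb hab
      have := hab.symm
      have := hab.ne
      rw [Sym2.eq_iff]
      clear hc1 hc2 hf hs hi hu
      grind
    refine ⟨c', ?_, ?_⟩
    · intro a ha b hb hab
      have := hab.symm
      have := hab.ne
      clear hsplit hc2 hs hi hu hf
      grind
    · intro a ha b hb a' ha' b' hb' hab hab' hm
      rcases hsplit a ha b hb hab with ⟨h1, h2, h3⟩ | ⟨h1, h2⟩ <;>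
        rcases hsplit a' ha' b' hb' hab' with ⟨h1', h2', h3'⟩ | ⟨h1', h2'⟩
      · rw [h3, h3']
        exact hc2 a h1 b h2 a' h1' b' h2' hab hab' hm
      · rw [h3, h2', hf a h1 b h2 hab (h1' ▸ hs _ _ hm)]
        exact hxf.symm
      · rw [h2, h3', hf a' h1' b' h2' hab' (h1 ▸ hm)]
        exact hxf
      · exact absurd (h1' ▸ h1 ▸ hm) (hi _)
  · push Not at h
    have hmem : ∀ a ∈ S, ∀ b ∈ S, L.Adj a b → a ∈ S.erase e := by
      intro a ha b hb hab
      refine Finset.mem_erase.2 ⟨?_, ha⟩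
      rintro rfl
      exact h b hb hab
    refine ⟨c, fun a ha b hb hab => ?_, fun a ha b hb a' ha' b' hb' hab hab' hm => ?_⟩
    · exact hc1 a (hmem a ha b hb hab) b (hmem b hb a ha hab.symm) hab
    · exact hc2 a (hmem a ha b hb hab) b (hmem b hb a ha hab.symm) a' (hmem a' ha' b' hb' hab')
        b' (hmem b' hb' a' ha' hab'.symm) hab hab' hm

theorem exists_two_colors : ∀ p q f₁ f₂ : ZMod 3, f₁ ≠ f₂ →
    ∃ x y, x ≠ y ∧ x ≠ p ∧ y ≠ q ∧ x + p ≠ f₁ ∧ y + q ≠ f₂ := by decide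

theorem exists_two_colors_sum_ne : ∀ p q : ZMod 3,
    ∃ x y, x ≠ y ∧ x ≠ p ∧ y ≠ q ∧ x + p ≠ y + q := by decide

theorem IsGoodOn.exists_of_erase_erase {E : Type*} [DecidableEq E] {L : SimpleGraph E}
    {M : Sym2 E → Sym2 E → Prop} (hM : IsPartialMatching M) {S : Finset E} {e e' g g' : E}
    (hee' : L.Adj e e') (heg : L.Adj e g) (heg' : L.Adj e' g') (hne : g ≠ e') (hne' : g' ≠ e)
    (he : ∀ a, L.Adj e a → a = e' ∨ a = g) (he' : ∀ a, L.Adj e' a → a = e ∨ a = g')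
    (hfree : ∀ k, ¬ M s(e, e') k) {c : E → ZMod 3}
    (hc : IsGoodOn L (rematch M s(e, g) s(e', g')) ((S.erase e).erase e') c) :
    ∃ c', IsGoodOn L M S c' := by
  obtain ⟨hc1, hc2⟩ := hc
  obtain ⟨hs, hi, hu⟩ := id hM
  have n1 := hee'.ne
  have n2 := heg.ne
  have n3 := heg'.ne
  set T := (S.erase e).erase e' with hT
  have hAB : s(e, g) ≠ s(e', g') := by
    rw [Ne, Sym2.eq_iff]; grind
  obtain ⟨x, y, hxy, hxp, hyq, hA, hB, hMAB⟩ : ∃ x y, x ≠ y ∧ x ≠ c g ∧ y ≠ c g' ∧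
      (∀ a ∈ T, ∀ b ∈ T, L.Adj a b → M s(e, g) s(a, b) → x + c g ≠ c a + c b) ∧
      (∀ a ∈ T, ∀ b ∈ T, L.Adj a b → M s(e', g') s(a, b) → y + c g' ≠ c a + c b) ∧
      (M s(e, g) s(e', g') → x + c g ≠ y + c g') := by
    by_cases hm : M s(e, g) s(e', g')
    · obtain ⟨x, y, h1, h2, h3, h4⟩ := exists_two_colors_sum_ne (c g) (c g')
      refine ⟨x, y, h1, h2, h3, ?_, ?_, fun _ => h4⟩
      · intro a ha b hb hab h
        have := hu _ _ _ hm h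
        rw [Sym2.eq_iff] at this
        clear hc1 hc2 hs hi hu hfree he he'
        grind
      · intro a ha b hb hab h
        have := hu _ _ _ (hs _ _ hm) h
        rw [Sym2.eq_iff] at this
        clear hc1 hc2 hs hi hu hfree he he'
        grind
    · obtain ⟨f₁, f₂, hf, hf₁, hf₂⟩ : ∃ f₁ f₂, f₁ ≠ f₂ ∧
          (∀ a ∈ T, ∀ b ∈ T, L.Adj a b → M s(e, g) s(a, b) → c a + c b = f₁) ∧
          (∀ a ∈ T, ∀ b ∈ T, L.Adj a b → M s(e', g') s(a, b) → c a + c b = f₂) := by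
        obtain ⟨f₁, hf₁⟩ := exists_partner_sum L hM T c s(e, g)
        obtain ⟨f₂, hf₂⟩ := exists_partner_sum L hM T c s(e', g')
        by_cases hex : ∃ a ∈ T, ∃ b ∈ T, L.Adj a b ∧ M s(e, g) s(a, b)
        · by_cases hex' : ∃ a ∈ T, ∃ b ∈ T, L.Adj a b ∧ M s(e', g') s(a, b)
          · refine ⟨f₁, f₂, ?_, hf₁, hf₂⟩
            obtain ⟨a, ha, b, hb, hab, h⟩ := hex
            obtain ⟨a', ha', b', hb', hab', h'⟩ := hex'
            rw [← hf₁ a ha b hb hab h, ← hf₂ a' ha' b' hb' hab' h']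
            exact hc2 a ha b hb a' ha' b' hb' hab hab' (Or.inr ⟨hm, Or.inl ⟨h, h'⟩⟩)
          · exact ⟨f₁, f₁ + 1, by simp, hf₁,
              fun a ha b hb hab h => absurd ⟨a, ha, b, hb, hab, h⟩ hex'⟩
        · exact ⟨f₂ + 1, f₂, by simp,
            fun a ha b hb hab h => absurd ⟨a, ha, b, hb, hab, h⟩ hex, hf₂⟩
      obtain ⟨x, y, h1, h2, h3, h4, h5⟩ := exists_two_colors (c g) (c g') f₁ f₂ hf
      exact ⟨x, y, h1, h2, h3, fun a ha b hb hab h => by rwa [hf₁ a ha b hb hab h],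
        fun a ha b hb hab h => by rwa [hf₂ a ha b hb hab h], fun h => absurd h hm⟩
  let c' := Function.update (Function.update c e x) e' y
  have ce : c' e = x := by simp [c', n1]
  have ce' : c' e' = y := by simp [c']
  have co : ∀ a, a ≠ e → a ≠ e' → c' a = c a := fun a h h' => by simp [c', h, h']
  clear_value c'
  have hsplit : ∀ a ∈ S, ∀ b ∈ S, L.Adj a b →
      (a ∈ T ∧ b ∈ T ∧ s(a, b) ≠ s(e, g) ∧ s(a, b) ≠ s(e', g') ∧ c' a + c' b = c a + c b) ∨
      s(a, b) = s(e, e') ∨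
      (s(a, b) = s(e, g) ∧ c' a + c' b = x + c g) ∨
      (s(a, b) = s(e', g') ∧ c' a + c' b = y + c g') := by
    intro a ha b hb hab
    have := hab.symm
    have := hab.ne
    simp only [Ne, Sym2.eq_iff]
    clear hc1 hc2 hA hB hs hi hu hMAB hAB hfree
    grind
  refine ⟨c', ?_, ?_⟩
  · intro a ha b hb hab
    have := hab.symm
    have := hab.ne
    clear hsplit hc2 hA hB hs hi hu hMAB hAB hfree
    grind
  · intro a ha b hb a' ha' b' hb' hab hab' hm
    rcases hsplit a ha b hb hab with ⟨h1, h2, h4, h5, h3⟩ | h1 | ⟨h1, h3⟩ | ⟨h1, h3⟩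
    · rcases hsplit a' ha' b' hb' hab' with
        ⟨h1', h2', h4', h5', h3'⟩ | h1' | ⟨h1', h3'⟩ | ⟨h1', h3'⟩
      · rw [h3, h3']
        exact hc2 a h1 b h2 a' h1' b' h2' hab hab' (Or.inl ⟨hm, h4, h5, h4', h5'⟩)
      · exact absurd (h1' ▸ hs _ _ hm) (hfree _)
      · rw [h3, h3']
        exact (hA a h1 b h2 hab (h1' ▸ hs _ _ hm)).symm
      · rw [h3, h3']
        exact (hB a h1 b h2 hab (h1' ▸ hs _ _ hm)).symm
    · exact absurd (h1 ▸ hm) (hfree _)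
    · rw [h1] at hm
      rcases hsplit a' ha' b' hb' hab' with
        ⟨h1', h2', h4', h5', h3'⟩ | h1' | ⟨h1', h3'⟩ | ⟨h1', h3'⟩
      · rw [h3, h3']
        exact hA a' h1' b' h2' hab' hm
      · exact absurd (h1' ▸ hs _ _ hm) (hfree _)
      · exact absurd (h1' ▸ hm) (hi _)
      · rw [h3, h3']
        exact hMAB (h1' ▸ hm)
    · rw [h1] at hm
      rcases hsplit a' ha' b' hb' hab' with
        ⟨h1', h2', h4', h5', h3'⟩ | h1' | ⟨h1', h3'⟩ | ⟨h1', h3'⟩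
      · rw [h3, h3']
        exact hB a' h1' b' h2' hab' hm
      · exact absurd (h1' ▸ hs _ _ hm) (hfree _)
      · rw [h3, h3']
        exact (hMAB (h1' ▸ hs _ _ hm)).symm
      · exact absurd (h1' ▸ hm) (hi _)

/-- In a graph of maximum degree two whose matched edges form a linear forest (as witnessed by
`rank`), a proper 3-coloring can give matched edges different color sums. -/
theorem exists_isGoodOn {E : Type*} (L : SimpleGraph E)
    (hdeg : ∀ e a b d, L.Adj e a → L.Adj e b → L.Adj e d → a = b ∨ a = d ∨ b = d)
    (rank : E → ℕ) (S : Finset E) (M : Sym2 E → Sym2 E → Prop) (hM : IsPartialMatching M)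
    (hrank : ∀ e a b k l, L.Adj e a → L.Adj e b → M s(e, a) k → M s(e, b) l →
      rank e ≤ rank a → rank e ≤ rank b → a = b) :
    ∃ c, IsGoodOn L M S c := by
  classical
  induction S using Finset.strongInduction generalizing M with
  | H S ih =>
  by_cases hleaf : ∃ e ∈ S, ∀ a ∈ S, ∀ b ∈ S, L.Adj e a → L.Adj e b → a = b
  · obtain ⟨e, he, hone⟩ := hleaf
    obtain ⟨c, hc⟩ := ih _ (Finset.erase_ssubset he) M hM hrank
    exact hc.exists_of_erase hM hone
  push Not at hleaf
  rcases S.eq_empty_or_nonempty with rfl | hS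
  · exact ⟨0, by simp [IsGoodOn]⟩
  obtain ⟨e, he, hmin⟩ := S.exists_min_image rank hS
  obtain ⟨e', he', g, hg, hee', heg, hne, hfree⟩ : ∃ e' ∈ S, ∃ g ∈ S, L.Adj e e' ∧ L.Adj e g ∧
      g ≠ e' ∧ ∀ k, ¬ M s(e, e') k := by
    obtain ⟨a, ha, b, hb, hea, heb, hab⟩ := hleaf e he
    by_cases h : ∃ k, M s(e, a) k
    · obtain ⟨k, hk⟩ := h
      refine ⟨b, hb, a, ha, heb, hea, hab, fun l hl => hab ?_⟩
      exact hrank e a b k l hea heb hk hl (hmin a ha) (hmin b hb)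
    · exact ⟨a, ha, b, hb, hea, heb, hab.symm, by simpa using h⟩
  obtain ⟨g', hg', heg', hne'⟩ : ∃ g' ∈ S, L.Adj e' g' ∧ g' ≠ e := by
    obtain ⟨a, ha, b, hb, hea, heb, hab⟩ := hleaf e' he'
    by_cases h : a = e
    · exact ⟨b, hb, heb, by grind⟩
    · exact ⟨a, ha, hea, h⟩
  have hAB : s(e, g) ≠ s(e', g') := by
    have := hee'.ne
    rw [Ne, Sym2.eq_iff]; grind
  obtain ⟨c, hc⟩ := ih ((S.erase e).erase e')
    ((Finset.erase_subset _ _).trans_ssubset (Finset.erase_ssubset he)) _ (hM.rematch hAB) (by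
      intro e a b k l ha hb hk hl h1 h2
      obtain ⟨k', hk'⟩ := matched_of_rematch hM hk
      obtain ⟨l', hl'⟩ := matched_of_rematch hM hl
      exact hrank e a b k' l' ha hb hk' hl' h1 h2)
  refine hc.exists_of_erase_erase hM hee' heg heg' hne hne' ?_ ?_ hfree
  · intro a ha
    have := hdeg e a e' g ha hee' heg
    grind
  · intro a ha
    have := hdeg e' a e g' ha hee'.symm heg'
    grind

/-- `pos` numbers the vertices along each path of the long path system `F`. -/
structure IsPosition {V : Type*} (F : SimpleGraph V) (pos : V → ℕ) : Prop where
  step : ∀ u v, F.Adj u v → pos v = pos u + 1 ∨ pos u = pos v + 1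
  inj : ∀ u v w, F.Adj u v → F.Adj u w → pos v = pos w → v = w
  exists_adj : ∀ v, ∃ w, F.Adj v w
  exists_adj_adj : ∀ u v, F.Adj u v → ∃ w, (w ≠ v ∧ F.Adj u w) ∨ (w ≠ u ∧ F.Adj v w)

theorem exists_isPosition {V : Type*} (F : SimpleGraph V)
    (hF : ∀ c : F.ConnectedComponent, ∃ n : ℕ, 3 ≤ n ∧ IsPathOn (F.induce c.supp) n) :
    ∃ pos, IsPosition F pos := by
  classical
  choose n hn hiso using hF
  let iso := fun c => (hiso c).some
  let posIn : F.ConnectedComponent → V → ℕ := fun c v =>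
    if h : v ∈ c.supp then (iso c ⟨v, h⟩).val else 0
  have posIn_inj : ∀ c, ∀ v ∈ c.supp, ∀ w ∈ c.supp, posIn c v = posIn c w → v = w := by
    intro c v hv w hw h
    simp only [posIn, hv, hw, dite_true] at h
    simpa using (iso c).injective (Fin.ext h)
  have posIn_lt : ∀ c, ∀ v ∈ c.supp, posIn c v < n c := by
    intro c v hv
    simp only [posIn, hv, dite_true]
    exact (iso c ⟨v, hv⟩).isLt
  have posIn_surj : ∀ c, ∀ i < n c, ∃ v ∈ c.supp, posIn c v = i := by
    intro c i hi
    obtain ⟨v, hv⟩ := (iso c).surjective ⟨i, hi⟩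
    refine ⟨v.1, v.2, ?_⟩
    have hv2 := v.2
    simp only [posIn, hv2, dite_true, Subtype.coe_eta, hv]
  have posIn_adj : ∀ c, ∀ v ∈ c.supp, ∀ w ∈ c.supp,
      (F.Adj v w ↔ posIn c v + 1 = posIn c w ∨ posIn c w + 1 = posIn c v) := by
    intro c v hv w hw
    simp only [posIn, hv, hw, dite_true]
    rw [← SimpleGraph.pathGraph_adj, (iso c).map_adj_iff]
    rfl
  have hmk : ∀ u v, F.Adj u v → F.connectedComponentMk v = F.connectedComponentMk u :=
    fun u v h => SimpleGraph.ConnectedComponent.connectedComponentMk_eq_of_adj h.symm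
  have hmem : ∀ u v, F.Adj u v → v ∈ (F.connectedComponentMk u).supp := fun u v h => hmk u v h
  have hself : ∀ u, u ∈ (F.connectedComponentMk u).supp := fun u => rfl
  refine ⟨fun v => posIn (F.connectedComponentMk v) v, ?_, ?_, ?_, ?_⟩
  · intro u v h
    have := (posIn_adj _ u (hself u) v (hmem u v h)).1 h
    simp only [hmk u v h]
    omega
  · intro u v w hv hw h
    simp only [hmk u v hv, hmk u w hw] at h
    exact posIn_inj _ v (hmem u v hv) w (hmem u w hw) h
  · intro v
    have h1 := hn (F.connectedComponentMk v)
    have h2 := posIn_lt _ v (hself v)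
    have key : ∀ i < n (F.connectedComponentMk v),
        (posIn (F.connectedComponentMk v) v + 1 = i ∨
          i + 1 = posIn (F.connectedComponentMk v) v) → ∃ w, F.Adj v w := by
      intro i hi h
      obtain ⟨w, hw, hwi⟩ := posIn_surj _ i hi
      exact ⟨w, (posIn_adj _ v (hself v) w hw).2 (hwi ▸ h)⟩
    by_cases h0 : posIn (F.connectedComponentMk v) v = 0
    · exact key 1 (by omega) (by omega)
    · exact key (posIn (F.connectedComponentMk v) v - 1) (by omega) (by omega)
  · intro u v h
    set c := F.connectedComponentMk u
    have h1 := hn c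
    have hu := hself u
    have hv := hmem u v h
    have h2 := posIn_lt c u hu
    have h3 := posIn_lt c v hv
    have h4 := (posIn_adj c u hu v hv).1 h
    have key : ∀ i < n c, i ≠ posIn c u → i ≠ posIn c v →
        (posIn c u + 1 = i ∨ i + 1 = posIn c u ∨ posIn c v + 1 = i ∨ i + 1 = posIn c v) →
        ∃ w, (w ≠ v ∧ F.Adj u w) ∨ (w ≠ u ∧ F.Adj v w) := by
      intro i hi hiu hiv hadj
      obtain ⟨w, hw, rfl⟩ := posIn_surj c i hi
      have hwu : w ≠ u := by rintro rfl; exact hiu rfl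
      have hwv : w ≠ v := by rintro rfl; exact hiv rfl
      have e1 := posIn_adj c u hu w hw
      have e2 := posIn_adj c v hv w hw
      exact ⟨w, by tauto⟩
    obtain ⟨i, hi, hi'⟩ : ∃ i < n c, i ≠ posIn c u ∧ i ≠ posIn c v ∧
        (posIn c u + 1 = i ∨ i + 1 = posIn c u ∨ posIn c v + 1 = i ∨ i + 1 = posIn c v) := by
      by_cases h0 : min (posIn c u) (posIn c v) = 0
      · exact ⟨2, by omega, by omega, by omega, by omega⟩
      · exact ⟨min (posIn c u) (posIn c v) - 1, by omega, by omega, by omega, by omega⟩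
    exact key i hi hi'.1 hi'.2.1 hi'.2.2

section PathSystem

variable {V : Type*} {F : SimpleGraph V} {pos : V → ℕ}

theorem mem_edgeSet_and_mem_iff {a : Sym2 V} {x : V} :
    a ∈ F.edgeSet ∧ x ∈ a ↔ ∃ y, F.Adj x y ∧ a = s(x, y) := by
  constructor
  · rintro ⟨ha, y, rfl⟩
    exact ⟨y, ha, rfl⟩
  · rintro ⟨y, hy, rfl⟩
    exact ⟨hy, Sym2.mem_mk_left x y⟩

theorem IsPosition.edges_at (hp : IsPosition F pos) {a b d : Sym2 V} (ha : a ∈ F.edgeSet)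
    (hb : b ∈ F.edgeSet) (hd : d ∈ F.edgeSet) {x : V} (hxa : x ∈ a) (hxb : x ∈ b) (hxd : x ∈ d) :
    a = b ∨ a = d ∨ b = d := by
  obtain ⟨u, hu, rfl⟩ := mem_edgeSet_and_mem_iff.1 ⟨ha, hxa⟩
  obtain ⟨v, hv, rfl⟩ := mem_edgeSet_and_mem_iff.1 ⟨hb, hxb⟩
  obtain ⟨w, hw, rfl⟩ := mem_edgeSet_and_mem_iff.1 ⟨hd, hxd⟩
  have h1 := hp.step x u hu
  have h2 := hp.step x v hv
  have h3 := hp.step x w hw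
  have h4 := hp.inj x u v hu hv
  have h5 := hp.inj x u w hu hw
  have h6 := hp.inj x v w hv hw
  by_cases h : pos u = pos v
  · exact Or.inl (by rw [h4 h])
  by_cases h' : pos u = pos w
  · exact Or.inr (Or.inl (by rw [h5 h']))
  · exact Or.inr (Or.inr (by rw [h6 (by omega)]))

/-- The smaller position of the two ends of an edge. -/
def edgeRank (pos : V → ℕ) : Sym2 V → ℕ :=
  Sym2.lift ⟨fun u v => min (pos u) (pos v), fun _ _ => min_comm _ _⟩

theorem edgeRank_mk (u v : V) : edgeRank pos s(u, v) = min (pos u) (pos v) := rfl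

theorem IsPosition.eq_of_edgeRank_le (hp : IsPosition F pos) {e a b : Sym2 V}
    (he : e ∈ F.edgeSet) (ha : a ∈ F.edgeSet) (hb : b ∈ F.edgeSet) (hea : e ≠ a) (heb : e ≠ b)
    {x y : V} (hxe : x ∈ e) (hxa : x ∈ a) (hye : y ∈ e) (hyb : y ∈ b)
    (hra : edgeRank pos e ≤ edgeRank pos a) (hrb : edgeRank pos e ≤ edgeRank pos b) : a = b := by
  obtain ⟨u, v, huv, hpos, rfl⟩ : ∃ u v, F.Adj u v ∧ pos v = pos u + 1 ∧ e = s(u, v) := by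
    induction e using Sym2.ind with
    | _ u v =>
      rcases hp.step u v he with h | h
      · exact ⟨u, v, he, h, rfl⟩
      · exact ⟨v, u, SimpleGraph.Adj.symm he, h, Sym2.eq_swap⟩
  have key : ∀ z d, d ∈ F.edgeSet → s(u, v) ≠ d → z ∈ s(u, v) → z ∈ d →
      edgeRank pos s(u, v) ≤ edgeRank pos d → ∃ w, F.Adj v w ∧ pos w = pos v + 1 ∧ d = s(v, w) := by
    intro z d hd hne hze hzd hr
    obtain ⟨w, hw, rfl⟩ := mem_edgeSet_and_mem_iff.1 ⟨hd, hzd⟩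
    rw [edgeRank_mk, edgeRank_mk] at hr
    have hs := hp.step z w hw
    rcases Sym2.mem_iff.1 hze with rfl | rfl
    · have := hp.inj z v w huv hw (by omega)
      exact absurd (by rw [this]) hne
    · refine ⟨w, hw, ?_, rfl⟩
      by_contra h
      have := hp.inj z u w huv.symm hw (by omega)
      exact hne (by rw [this, Sym2.eq_swap])
  obtain ⟨w, hw, hpw, rfl⟩ := key x a ha hea hxe hxa hra
  obtain ⟨w', hw', hpw', rfl⟩ := key y b hb heb hye hyb hrb
  rw [hp.inj v w w' hw hw' (by omega)]

theorem eq_of_mem_of_mem {a b : Sym2 V} (hab : a ≠ b) {x y : V} (hxa : x ∈ a) (hxb : x ∈ b)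
    (hya : y ∈ a) (hyb : y ∈ b) : x = y := by
  by_contra h
  exact hab (Sym2.eq_of_ne_mem h hxa hya hxb hyb)

/-- `x` is incident with at most one edge of `F`. -/
def IsEnd (F : SimpleGraph V) (x : V) : Prop :=
  ∀ a ∈ F.edgeSet, ∀ b ∈ F.edgeSet, x ∈ a → x ∈ b → a = b

/-- The pair of edges of `F` meeting at `x` is `j`. -/
def IsJoint (F : SimpleGraph V) (x : V) (j : Sym2 (Sym2 V)) : Prop :=
  ∃ a ∈ F.edgeSet, ∃ b ∈ F.edgeSet, a ≠ b ∧ x ∈ a ∧ x ∈ b ∧ j = s(a, b)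

theorem IsJoint.mk_iff {x : V} {a b : Sym2 V} :
    IsJoint F x s(a, b) ↔ a ∈ F.edgeSet ∧ b ∈ F.edgeSet ∧ a ≠ b ∧ x ∈ a ∧ x ∈ b := by
  constructor
  · rintro ⟨a', ha', b', hb', hne, hxa, hxb, h⟩
    rcases Sym2.eq_iff.1 h with ⟨rfl, rfl⟩ | ⟨rfl, rfl⟩
    · exact ⟨ha', hb', hne, hxa, hxb⟩
    · exact ⟨hb', ha', hne.symm, hxb, hxa⟩
  · rintro ⟨ha, hb, hne, hxa, hxb⟩
    exact ⟨a, ha, b, hb, hne, hxa, hxb, rfl⟩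

theorem IsJoint.vertex_unique {x y : V} {j : Sym2 (Sym2 V)} (hx : IsJoint F x j)
    (hy : IsJoint F y j) : x = y := by
  obtain ⟨a, -, b, -, hne, hxa, hxb, rfl⟩ := hx
  obtain ⟨-, -, -, hya, hyb⟩ := IsJoint.mk_iff.1 hy
  exact eq_of_mem_of_mem hne hxa hxb hya hyb

theorem IsPosition.joint_unique (hp : IsPosition F pos) {x : V} {j k : Sym2 (Sym2 V)}
    (hj : IsJoint F x j) (hk : IsJoint F x k) : j = k := by
  obtain ⟨a, ha, b, hb, hne, hxa, hxb, rfl⟩ := hj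
  obtain ⟨a', ha', b', hb', hne', hxa', hxb', rfl⟩ := hk
  have h1 := hp.edges_at ha hb ha' hxa hxb hxa'
  have h2 := hp.edges_at ha hb hb' hxa hxb hxb'
  rw [Sym2.eq_iff]
  grind

/-- Edges of `F` are linked if they share a vertex or contain ends of `F` matched by `Q`. -/
def linkGraph (F : SimpleGraph V) (Q : V → V → Prop) (hQ : IsPartialMatching Q) :
    SimpleGraph (Sym2 V) where
  Adj a b := a ≠ b ∧ a ∈ F.edgeSet ∧ b ∈ F.edgeSet ∧
    ∃ x y, (x = y ∨ (Q x y ∧ IsEnd F x ∧ IsEnd F y)) ∧ x ∈ a ∧ y ∈ b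
  symm := ⟨by
    rintro a b ⟨hne, ha, hb, x, y, h, hx, hy⟩
    refine ⟨hne.symm, hb, ha, y, x, ?_, hy, hx⟩
    rcases h with h | ⟨h1, h2, h3⟩
    · exact Or.inl h.symm
    · exact Or.inr ⟨hQ.symm _ _ h1, h3, h2⟩⟩
  loopless := ⟨fun a h => h.1 rfl⟩

theorem IsPosition.linkGraph_degree_le_two (hp : IsPosition F pos) {Q : V → V → Prop}
    (hQ : IsPartialMatching Q) (e a b d : Sym2 V) (ha : (linkGraph F Q hQ).Adj e a)
    (hb : (linkGraph F Q hQ).Adj e b) (hd : (linkGraph F Q hQ).Adj e d) :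
    a = b ∨ a = d ∨ b = d := by
  have key : ∀ x y z a b, a ≠ e → b ≠ e → e ∈ F.edgeSet → a ∈ F.edgeSet → b ∈ F.edgeSet → x ∈ e →
      y ∈ a → z ∈ b → (x = y ∨ (Q x y ∧ IsEnd F x ∧ IsEnd F y)) →
      (x = z ∨ (Q x z ∧ IsEnd F x ∧ IsEnd F z)) → a = b := by
    intro x y z a b hae hbe he ha hb hxe hya hzb hy hz
    rcases hy with rfl | ⟨hy, hx, hy'⟩
    · rcases hz with rfl | ⟨hz, hx, hz'⟩
      · have := hp.edges_at he ha hb hxe hya hzb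
        grind
      · exact absurd (hx a ha e he hya hxe) hae
    · rcases hz with rfl | ⟨hz, -, hz'⟩
      · exact absurd (hx b hb e he hzb hxe) hbe
      · obtain rfl := hQ.unique _ _ _ hy hz
        exact hy' a ha b hb hya hzb
  obtain ⟨na, he, ea, x, x', hx, hxe, hxa⟩ := ha
  obtain ⟨nb, -, eb, y, y', hy, hye, hyb⟩ := hb
  obtain ⟨nd, -, ed, z, z', hz, hze, hzd⟩ := hd
  have h3 : x = y ∨ x = z ∨ y = z := by
    induction e using Sym2.ind with
    | _ u v =>
      rw [Sym2.mem_iff] at hxe hye hze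
      grind
  rcases h3 with rfl | rfl | rfl
  · exact Or.inl (key x x' y' a b na.symm nb.symm he ea eb hxe hxa hyb hx hy)
  · exact Or.inr (Or.inl (key x x' z' a d na.symm nd.symm he ea ed hxe hxa hzd hx hz))
  · exact Or.inr (Or.inr (key y y' z' b d nb.symm nd.symm he eb ed hye hyb hzd hy hz))

theorem IsPosition.exists_coloring [Finite V] (hp : IsPosition F pos) {Q : V → V → Prop}
    (hQ : IsPartialMatching Q) : ∃ c : Sym2 V → ZMod 3,
      (∀ a b, (linkGraph F Q hQ).Adj a b → c a ≠ c b) ∧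
      ∀ x y a b a' b', Q x y → IsJoint F x s(a, b) → IsJoint F y s(a', b') →
        c a + c b ≠ c a' + c b' := by
  classical
  have := Fintype.ofFinite V
  let M : Sym2 (Sym2 V) → Sym2 (Sym2 V) → Prop :=
    fun j k => ∃ x y, Q x y ∧ IsJoint F x j ∧ IsJoint F y k
  have hM : IsPartialMatching M := by
    refine ⟨?_, ?_, ?_⟩
    · rintro j k ⟨x, y, h, hj, hk⟩
      exact ⟨y, x, hQ.symm _ _ h, hk, hj⟩
    · rintro j ⟨x, y, h, hj, hk⟩
      obtain rfl := hj.vertex_unique hk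
      exact hQ.irrefl _ h
    · rintro j k k' ⟨x, y, h, hj, hk⟩ ⟨x', y', h', hj', hk'⟩
      obtain rfl := hj.vertex_unique hj'
      obtain rfl := hQ.unique _ _ _ h h'
      exact hp.joint_unique hk hk'
  obtain ⟨c, hc1, hc2⟩ := exists_isGoodOn (linkGraph F Q hQ) (hp.linkGraph_degree_le_two hQ)
    (edgeRank pos) Finset.univ M hM (by
      rintro e a b k l - - ⟨x, -, -, hx, -⟩ ⟨y, -, -, hy, -⟩ h1 h2
      obtain ⟨he, ha, hea, hxe, hxa⟩ := IsJoint.mk_iff.1 hx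
      obtain ⟨-, hb, heb, hye, hyb⟩ := IsJoint.mk_iff.1 hy
      exact hp.eq_of_edgeRank_le he ha hb hea heb hxe hxa hye hyb h1 h2)
  have hlink : ∀ x a b, IsJoint F x s(a, b) → (linkGraph F Q hQ).Adj a b := by
    intro x a b h
    obtain ⟨ha, hb, hab, hxa, hxb⟩ := IsJoint.mk_iff.1 h
    exact ⟨hab, ha, hb, x, x, Or.inl rfl, hxa, hxb⟩
  refine ⟨c, fun a b h => hc1 a (Finset.mem_univ _) b (Finset.mem_univ _) h, ?_⟩
  intro x y a b a' b' h hx hy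
  exact hc2 a (Finset.mem_univ _) b (Finset.mem_univ _) a' (Finset.mem_univ _) b'
    (Finset.mem_univ _) (hlink x a b hx) (hlink y a' b' hy) ⟨x, y, h, hx, hy⟩

theorem colorSet_eq_singleton (φ : Sym2 V → ℕ) {x : V} (hx : IsEnd F x) {a : Sym2 V}
    (ha : a ∈ F.edgeSet) (hxa : x ∈ a) : colorSet F φ x = {φ a} := by
  ext t
  constructor
  · rintro ⟨b, hb, hxb, rfl⟩
    rw [hx a ha b hb hxa hxb]; rfl
  · rintro rfl
    exact ⟨a, ha, hxa, rfl⟩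

theorem IsPosition.colorSet_eq_pair (hp : IsPosition F pos) (φ : Sym2 V → ℕ) {x : V}
    {a b : Sym2 V} (h : IsJoint F x s(a, b)) : colorSet F φ x = {φ a, φ b} := by
  obtain ⟨ha, hb, hab, hxa, hxb⟩ := IsJoint.mk_iff.1 h
  ext t
  constructor
  · rintro ⟨d, hd, hxd, rfl⟩
    rcases hp.edges_at ha hb hd hxa hxb hxd with h | rfl | rfl
    · exact absurd h hab
    · exact Or.inl rfl
    · exact Or.inr rfl
  · rintro (rfl | rfl)
    · exact ⟨a, ha, hxa, rfl⟩
    · exact ⟨b, hb, hxb, rfl⟩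

theorem IsPosition.isEnd_or_isJoint (hp : IsPosition F pos) (x : V) :
    (IsEnd F x ∧ ∃ a ∈ F.edgeSet, x ∈ a) ∨ ∃ a b, IsJoint F x s(a, b) := by
  obtain ⟨y, hy⟩ := hp.exists_adj x
  by_cases h : IsEnd F x
  · exact Or.inl ⟨h, s(x, y), hy, Sym2.mem_mk_left x y⟩
  · unfold IsEnd at h
    push Not at h
    obtain ⟨a, ha, b, hb, hxa, hxb, hab⟩ := h
    exact Or.inr ⟨a, b, IsJoint.mk_iff.2 ⟨ha, hb, hab, hxa, hxb⟩⟩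

theorem IsPosition.not_isEnd_isEnd (hp : IsPosition F pos) {x y : V} (hxy : F.Adj x y)
    (hx : IsEnd F x) (hy : IsEnd F y) : False := by
  obtain ⟨w, ⟨hne, hw⟩ | ⟨hne, hw⟩⟩ := hp.exists_adj_adj x y hxy
  · have := hx s(x, y) hxy s(x, w) hw (Sym2.mem_mk_left _ _) (Sym2.mem_mk_left _ _)
    exact hne (Sym2.congr_right.1 this).symm
  · have := hy s(y, x) hxy.symm s(y, w) hw (Sym2.mem_mk_left _ _) (Sym2.mem_mk_left _ _)
    exact hne (Sym2.congr_right.1 this).symm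

end PathSystem

/-- Lemma A (Bazgan–Harkat-Benhamdine–Li–Woźniak): if every component of `F` is a path on at
least 3 vertices (a long path system) and `B` is a set of pairwise disjoint `2`-element
subsets of `V(F)`, then `F` has an edge-3-coloring `φ` with `φ(x) ≠ φ(x')` for each pair
`{x,x'} ∈ B`. -/
theorem long_path_system_coloring {V : Type*} [Fintype V]
    (F : SimpleGraph V)
    (hF : ∀ c : F.ConnectedComponent, ∃ n : ℕ, 3 ≤ n ∧ IsPathOn (F.induce c.supp) n)
    (B : Set (Finset V)) (hB2 : ∀ p ∈ B, p.card = 2)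
    (hBdisj : ∀ p ∈ B, ∀ q ∈ B, p ≠ q → Disjoint p q) :
    ∃ φ : Sym2 V → ℕ, IsEdgeKColoring F 3 φ ∧
      ∀ p ∈ B, ∀ x ∈ p, ∀ x' ∈ p, x ≠ x' → colorSet F φ x ≠ colorSet F φ x' := by
  obtain ⟨pos, hp⟩ := exists_isPosition F hF
  let Q : V → V → Prop := fun x y => x ≠ y ∧ ∃ p ∈ B, x ∈ p ∧ y ∈ p
  have hQ : IsPartialMatching Q := by
    refine ⟨?_, fun x h => h.1 rfl, ?_⟩
    · rintro x y ⟨hne, p, hpB, hx, hy⟩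
      exact ⟨hne.symm, p, hpB, hy, hx⟩
    · rintro x y z ⟨hxy, p, hpB, hx, hy⟩ ⟨hxz, q, hqB, hx', hz⟩
      obtain rfl : p = q := by
        by_contra h
        exact Finset.disjoint_left.1 (hBdisj p hpB q hqB h) hx hx'
      by_contra hyz
      have := Finset.two_lt_card.2 ⟨x, hx, y, hy, z, hz, hxy, hxz, hyz⟩
      have := hB2 p hpB
      omega
  obtain ⟨c, hproper, hsum⟩ := hp.exists_coloring hQ
  let φ : Sym2 V → ℕ := fun e => (c e).val + 1
  have hφ : ∀ a b, φ a = φ b → c a = c b := fun a b h =>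
    ZMod.val_injective 3 (Nat.succ_injective h)
  have hjoint_ne : ∀ x a b, IsJoint F x s(a, b) → φ a ≠ φ b := by
    intro x a b h hab
    obtain ⟨ha, hb, hne, hxa, hxb⟩ := IsJoint.mk_iff.1 h
    exact hproper a b ⟨hne, ha, hb, x, x, Or.inl rfl, hxa, hxb⟩ (hφ a b hab)
  refine ⟨φ, ⟨?_, ?_⟩, ?_⟩
  · intro e _
    have := ZMod.val_lt (c e)
    exact Finset.mem_Icc.2 ⟨Nat.le_add_left 1 _, this⟩
  · rintro a ha b hb hne ⟨v, hva, hvb⟩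
    exact hjoint_ne v a b (IsJoint.mk_iff.2 ⟨ha, hb, hne, hva, hvb⟩)
  · intro p hpB x hx y hy hxy hcol
    have hxyQ : Q x y := ⟨hxy, p, hpB, hx, hy⟩
    rcases hp.isEnd_or_isJoint x with ⟨hex, a, ha, hxa⟩ | ⟨a, b, hab⟩ <;>
      rcases hp.isEnd_or_isJoint y with ⟨hey, a', ha', hya'⟩ | ⟨a', b', hab'⟩
    · rw [colorSet_eq_singleton φ hex ha hxa, colorSet_eq_singleton φ hey ha' hya',
        Set.singleton_eq_singleton_iff] at hcol
      by_cases haa' : a = a'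
      · subst haa'
        rw [(Sym2.mem_and_mem_iff hxy).1 ⟨hxa, hya'⟩] at ha
        exact hp.not_isEnd_isEnd ha hex hey
      · exact hproper a a' ⟨haa', ha, ha', x, y, Or.inr ⟨hxyQ, hex, hey⟩, hxa, hya'⟩
          (hφ a a' hcol)
    · rw [colorSet_eq_singleton φ hex ha hxa, hp.colorSet_eq_pair φ hab'] at hcol
      have h := congrArg Set.ncard hcol
      rw [Set.ncard_singleton, Set.ncard_pair (hjoint_ne y a' b' hab')] at h
      omega
    · rw [colorSet_eq_singleton φ hey ha' hya', hp.colorSet_eq_pair φ hab] at hcol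
      have h := congrArg Set.ncard hcol
      rw [Set.ncard_singleton, Set.ncard_pair (hjoint_ne x a b hab)] at h
      omega
    · rw [hp.colorSet_eq_pair φ hab, hp.colorSet_eq_pair φ hab', Set.pair_eq_pair_iff] at hcol
      refine hsum x y a b a' b' hxyQ hab hab' ?_
      rcases hcol with ⟨h1, h2⟩ | ⟨h1, h2⟩
      · rw [hφ _ _ h1, hφ _ _ h2]
      · rw [hφ _ _ h1, hφ _ _ h2, add_comm]
end
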